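/- Let G be a fair complete k-partite graph with k ≥ 3 whose edges are coloured red and blue. Then the vertex set of G can be partitioned into the vertex set of a red path and the vertex set of a blue path; that is, there exist a vertex-disjoint red path and blue path whose vertex sets together cover all of V(G). -/

import Mathlib

open SimpleGraph Set

/- Convention: colour `true` is red, colour `false` is blue. -/

/-- The subgraph of `G` consisting of the edges of colour `b`. -/
def monoSubgraph {V : Type*} (G : SimpleGraph V) (c : Sym2 V → Bool) (b : Bool) :
    SimpleGraph V :=
  SimpleGraph.fromEdgeSet {e | e ∈ G.edgeSet ∧ c e = b}

/-- `S` is the vertex set of a (possibly empty, possibly trivial) path of `G`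
all of whose edges have colour `b`. -/
def IsMonoPathSet {V : Type*} (G : SimpleGraph V) (c : Sym2 V → Bool) (b : Bool)
    (S : Set V) : Prop :=
  S = ∅ ∨ ∃ (u v : V) (p : G.Walk u v), p.IsPath ∧ (∀ e ∈ p.edges, c e = b) ∧
    S = {x | x ∈ p.support}

/-- `S` is the vertex set of a (possibly degenerate: empty, single vertex or single edge)
cycle of `G` all of whose edges have colour `b`. -/
def IsMonoCycleSet {V : Type*} (G : SimpleGraph V) (c : Sym2 V → Bool) (b : Bool)
    (S : Set V) : Prop :=
  S = ∅ ∨ (∃ v, S = {v}) ∨ (∃ u v, G.Adj u v ∧ c s(u, v) = b ∧ S = {u, v}) ∨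
    ∃ (v : V) (p : G.Walk v v), p.IsCycle ∧ (∀ e ∈ p.edges, c e = b) ∧
      S = {x | x ∈ p.support}

/-- `M` is a matching of `G` in colour `b` which is connected, i.e. all its edges lie in one
connected component of the subgraph formed by the edges of colour `b`. -/
def IsConnMatching {V : Type*} (G : SimpleGraph V) (c : Sym2 V → Bool) (b : Bool)
    (M : Set (Sym2 V)) : Prop :=
  (∀ e ∈ M, e ∈ G.edgeSet ∧ c e = b) ∧
  (∀ e ∈ M, ∀ f ∈ M, e ≠ f → ∀ x, x ∈ e → x ∉ f) ∧
  (∀ e ∈ M, ∀ f ∈ M, ∀ x, x ∈ e → ∀ y, y ∈ f → (monoSubgraph G c b).Reachable x y)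

/-- The set of vertices covered by a set of edges. -/
def matchSupport {V : Type*} (M : Set (Sym2 V)) : Set V := {x | ∃ e ∈ M, x ∈ e}

/-- The colouring `c` of the (bipartite, with classes `U` and `W`) graph `G` is a split
colouring: `U = A ∪ B`, `W = C ∪ D`, the edges between `A,C` and between `B,D` are blue
(`false`), and the edges between `A,D` and between `B,C` are red (`true`). -/
def IsSplitColouring {V : Type*} (G : SimpleGraph V) (c : Sym2 V → Bool)
    (U W : Set V) : Prop :=
  ∃ A B C D : Set V,
    A ∪ B = U ∧ Disjoint A B ∧ C ∪ D = W ∧ Disjoint C D ∧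
    (∀ u v, G.Adj u v →
      (((u ∈ A ∧ v ∈ C) ∨ (u ∈ C ∧ v ∈ A) ∨ (u ∈ B ∧ v ∈ D) ∨ (u ∈ D ∧ v ∈ B)) →
        c s(u, v) = false)) ∧
    (∀ u v, G.Adj u v →
      (((u ∈ A ∧ v ∈ D) ∨ (u ∈ D ∧ v ∈ A) ∨ (u ∈ B ∧ v ∈ C) ∨ (u ∈ C ∧ v ∈ B)) →
        c s(u, v) = true))

/-- The colouring `c` of `G` is `δ`-close to a split colouring: one can delete at most
`δ|E(G)|` edges so that the remaining graph is bipartite and the colouring on it is a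
split colouring. -/
def CloseToSplit {V : Type*} (G : SimpleGraph V) (c : Sym2 V → Bool) (δ : ℝ) : Prop :=
  ∃ F : Set (Sym2 V), F ⊆ G.edgeSet ∧ (F.ncard : ℝ) ≤ δ * (G.edgeSet.ncard : ℝ) ∧
    ∃ U W : Set V, U ∪ W = Set.univ ∧ Disjoint U W ∧
      (∀ u v, (G.deleteEdges F).Adj u v → ((u ∈ U ∧ v ∈ W) ∨ (u ∈ W ∧ v ∈ U))) ∧
      IsSplitColouring (G.deleteEdges F) c U W


/-- `PathOn R a s b`: the elements of the multiset `s` can be ordered into a list which starts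
with `a`, ends with `b`, and has consecutive elements related by `R`. -/
inductive PathOn {V : Type*} (R : V → V → Prop) : V → Multiset V → V → Prop
  | single (a : V) : PathOn R a {a} a
  | cons {a b d : V} {s : Multiset V} (h : R a b) (hp : PathOn R b s d) :
      PathOn R a ({a} + s) d

/-- A pair of symmetric relations (the red and the blue edges) covering the complete multipartite
graph whose classes are the fibres of `f`. -/
structure TwoColouring {V κ : Type*} (f : V → κ) (R B : V → V → Prop) : Prop where
  red_symm : ∀ {x y}, R x y → R y x
  blue_symm : ∀ {x y}, B x y → B y x
  red_ne : ∀ {x y}, R x y → f x ≠ f y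
  blue_ne : ∀ {x y}, B x y → f x ≠ f y
  total : ∀ {x y}, f x ≠ f y → R x y ∨ B x y

/-- The multiset `m` splits into a red path and a blue path, either of which may be empty. -/
def Splits {V : Type*} (R B : V → V → Prop) (m : Multiset V) : Prop :=
  ∃ s t, s + t = m ∧ (s = 0 ∨ ∃ a b, PathOn R a s b) ∧ (t = 0 ∨ ∃ a b, PathOn B a t b)

namespace PathOn
variable {V : Type*} {R : V → V → Prop} {a b d e : V} {s t : Multiset V}

theorem append (h : PathOn R a s b) (e : R b d) (h' : PathOn R d t e') :
    PathOn R a (s + t) e' := by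
  induction h with
  | single a => exact .cons e h'
  | cons h hp ih => rw [add_assoc]; exact .cons h (ih e)

theorem congr (h : PathOn R a s b) (e : s = t) : PathOn R a t b := e ▸ h

theorem snoc (h : PathOn R a s b) (e : R b d) : PathOn R a (s + {d}) d :=
  h.append e (.single d)

theorem symm (hR : ∀ {x y}, R x y → R y x) (h : PathOn R a s b) : PathOn R b s a := by
  induction h with
  | single a => exact .single a
  | cons h hp ih => rw [add_comm]; exact ih.snoc (hR h)

theorem start_mem (h : PathOn R a s b) : a ∈ s := by
  cases h <;> simp

theorem end_mem (h : PathOn R a s b) : b ∈ s := by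
  induction h with
  | single a => simp
  | cons h hp ih => simp [ih]

theorem ne_zero (h : PathOn R a s b) : s ≠ 0 := by
  rintro rfl; simpa using h.start_mem

/-- Splitting off the last element. -/
theorem end_cases (hR : ∀ {x y}, R x y → R y x) (h : PathOn R a s b) :
    (s = {b} ∧ a = b) ∨ ∃ y u, PathOn R a u y ∧ R y b ∧ s = {b} + u := by
  cases h.symm hR with
  | single => exact .inl ⟨rfl, rfl⟩
  | cons e hp => exact .inr ⟨_, _, hp.symm hR, hR e, rfl⟩

theorem start_cases (h : PathOn R a s b) :
    (s = {a} ∧ a = b) ∨ ∃ y u, PathOn R y u b ∧ R a y ∧ s = {a} + u := by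
  cases h with
  | single => exact .inl ⟨rfl, rfl⟩
  | cons h hp => exact .inr ⟨_, _, hp, h, rfl⟩

/-- Splitting a path after one of its vertices. -/
theorem split (h : PathOn R a s b) {z : V} (hz : z ∈ s) :
    ∃ u, PathOn R a u z ∧ ((z = b ∧ s = u) ∨
      ∃ y w, R z y ∧ PathOn R y w b ∧ s = u + w) := by
  induction h with
  | single a =>
    obtain rfl : z = a := by simpa using hz
    exact ⟨_, .single _, .inl ⟨rfl, rfl⟩⟩
  | @cons a b d s h hp ih =>
    by_cases hza : z = a
    · subst hza
      exact ⟨_, .single _, .inr ⟨_, _, h, hp, rfl⟩⟩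
    · obtain ⟨u, h1, h2⟩ := ih (by simpa [hza] using hz)
      refine ⟨_, .cons h h1, ?_⟩
      rcases h2 with ⟨rfl, rfl⟩ | ⟨y, w, h2, h3, rfl⟩
      · exact .inl ⟨rfl, rfl⟩
      · exact .inr ⟨y, w, h2, h3, by abel⟩

/-- A cycle can be cut open at any of its vertices. -/
theorem rotate (hR : ∀ {x y}, R x y → R y x) (h : PathOn R a s b) (hba : R b a) {z : V}
    (hz : z ∈ s) : ∃ y, PathOn R z s y ∧ R y z := by
  obtain ⟨u, h1, ⟨rfl, rfl⟩ | ⟨y, w, h2, h3, rfl⟩⟩ := h.split hz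
  · exact ⟨a, h.symm hR, hR hba⟩
  · exact ⟨y, (h1.symm hR).append (hR hba) (h3.symm hR), hR h2⟩

/-- Removing one vertex from a cycle leaves a path. -/
theorem remove (hR : ∀ {x y}, R x y → R y x) (h : PathOn R a s b) (hba : R b a) {z : V}
    (hz : z ∈ s) : s = {z} ∨ ∃ x y u, PathOn R x u y ∧ R z x ∧ R y z ∧ s = {z} + u := by
  obtain ⟨y, h1, h2⟩ := h.rotate hR hba hz
  rcases h1.start_cases with ⟨h3, -⟩ | ⟨x, u, h3, h4, h5⟩
  · exact .inl h3
  · exact .inr ⟨x, y, u, h3, h4, h2, h5⟩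

end PathOn

namespace Splits
variable {V : Type*} {R B : V → V → Prop} {m s t : Multiset V}

theorem swap (h : Splits R B m) : Splits B R m := by
  obtain ⟨s, t, h, hs, ht⟩ := h
  exact ⟨t, s, by rw [add_comm, h], ht, hs⟩

theorem of_paths {a b d e : V} (h : PathOn R a s b) (h' : PathOn B d t e) (hm : s + t = m) :
    Splits R B m := ⟨s, t, hm, .inr ⟨a, b, h⟩, .inr ⟨d, e, h'⟩⟩

theorem of_path {a b : V} (h : PathOn R a s b) (hm : s = m) : Splits R B m :=
  ⟨s, 0, by simpa, .inr ⟨a, b, h⟩, .inl rfl⟩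

theorem of_singleton_right {a b : V} (v : V) (h : PathOn R a s b) (hm : s + {v} = m) :
    Splits R B m := of_paths h (.single v) hm

end Splits

namespace TwoColouring
variable {V κ : Type*} {f : V → κ} {R B : V → V → Prop} {m : Multiset V}

theorem swap (h : TwoColouring f R B) : TwoColouring f B R :=
  ⟨h.blue_symm, h.red_symm, h.blue_ne, h.red_ne, fun e => (h.total e).symm⟩

theorem blue_of_not_red (h : TwoColouring f R B) {x y : V} (hxy : f x ≠ f y) (hr : ¬ R x y) :
    B x y := (h.total hxy).resolve_left hr

theorem red_of_not_blue (h : TwoColouring f R B) {x y : V} (hxy : f x ≠ f y) (hr : ¬ B x y) :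
    R x y := (h.total hxy).resolve_right hr

end TwoColouring

/-- Either some edge of the path avoids the class `q`, or about half of the path is in `q`. -/
theorem PathOn.slack_or_card_le {V κ : Type*} [DecidableEq κ] {f : V → κ} {R : V → V → Prop}
    {a b : V} {s : Multiset V} (h : PathOn R a s b) (q : κ) :
    (∃ x y u w, PathOn R a u x ∧ R x y ∧ PathOn R y w b ∧ s = u + w ∧ f x ≠ q ∧ f y ≠ q) ∨
    s.card + (if f a = q then 1 else 0) + (if f b = q then 1 else 0) ≤
      2 * s.countP (f · = q) + 1 := by
  induction h with
  | single a => by_cases h : f a = q <;> simp [h, ← Multiset.cons_zero]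
  | @cons a b d s h hp ih =>
    rcases ih with ⟨x, y, u, w, h1, h2, h3, rfl, h4, h5⟩ | ih
    · exact .inl ⟨x, y, _, w, .cons h h1, h2, h3, by abel, h4, h5⟩
    · by_cases ha : f a = q
      · right
        simp only [Multiset.singleton_add, Multiset.card_cons, ha, if_true,
          Multiset.countP_cons_of_pos]
        split_ifs at * <;> omega
      · by_cases hb : f b = q
        · right
          simp only [Multiset.singleton_add, Multiset.card_cons, ha, hb, if_true, if_false,
            not_false_eq_true, Multiset.countP_cons_of_neg] at *
          split_ifs at * <;> omega
        · exact .inl ⟨a, b, _, _, .single a, h, hp, rfl, ha, hb⟩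

namespace TwoColouring
variable {V κ : Type*} [DecidableEq κ] {f : V → κ} {R B : V → V → Prop} {m : Multiset V}

/-- The set `m` is a fair multiset of vertices meeting at least three classes. -/
structure Fair (f : V → κ) (m : Multiset V) : Prop where
  fair : ∀ q, 2 * m.countP (f · = q) ≤ m.card
  third : ∀ p q, ∃ x ∈ m, f x ≠ p ∧ f x ≠ q

theorem splits_of_matched_aux (h : TwoColouring f R B) (hm : Fair f m) {v : V} (N : ℕ) :
    ∀ {r₁ r₂ b₁ b₂ : V} {s t : Multiset V}, PathOn R r₁ s r₂ → PathOn B b₁ t b₂ →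
      s + t + {v} = m → f r₁ ≠ f b₁ → f r₂ ≠ f b₂ → t.card = N → Splits R B m := by
  induction N using Nat.strong_induction_on with
  | _ N ih =>
  intro r₁ r₂ b₁ b₂ s t hs ht hst h1 h2 hN
  by_contra hno
  have rs : ∀ {x y}, R x y → R y x := h.red_symm
  have bs : ∀ {x y}, B x y → B y x := h.blue_symm
  -- a red edge between corresponding ends could be used to lengthen the red path
  have shift : ∀ {r₁ r₂ b₁ b₂ : V}, PathOn R r₁ s r₂ → PathOn B b₁ t b₂ → f r₁ ≠ f b₁ →
      f r₂ ≠ f b₂ → ¬ R r₁ b₁ := by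
    intro r₁ r₂ b₁ b₂ hs ht h1 h2 hr
    rcases ht.start_cases with ⟨rfl, rfl⟩ | ⟨y, u, hu, e, rfl⟩
    · exact hno (.of_singleton_right v (.cons (rs hr) hs) (by grind (ematch := 0)))
    · refine hno (ih u.card ?_ (.cons (rs hr) hs) hu (by grind (ematch := 0)) (h.blue_ne e) h2 rfl)
      simp at hN; omega
  have attR : ∀ {a b : V}, PathOn R a s b → ¬ R v a := fun hs e =>
    hno (.of_paths (.cons e hs) ht (by grind (ematch := 0)))
  have attB : ∀ {a b : V}, PathOn B a t b → ¬ B v a := fun ht e =>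
    hno (.of_paths hs (.cons e ht) (by grind (ematch := 0)))
  have key : ∀ {r₁ r₂ b₁ b₂ : V}, PathOn R r₁ s r₂ → PathOn B b₁ t b₂ → f r₁ ≠ f b₁ →
      f r₂ ≠ f b₂ → f v = f r₁ := by
    intro r₁ r₂ b₁ b₂ hs ht h1 h2
    by_contra hv
    have e1 := h.blue_of_not_red h1 (shift hs ht h1 h2)
    have e2 := h.blue_of_not_red hv (attR hs)
    rcases hs.start_cases with ⟨rfl, rfl⟩ | ⟨y, u, hu, e, rfl⟩
    · exact hno (.swap (.of_path (.cons e2 (.cons e1 ht)) (by grind (ematch := 0))))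
    · exact hno (.of_paths hu (.cons e2 (.cons e1 ht)) (by grind (ematch := 0)))
  have hv1 := key hs ht h1 h2
  have hv2 := key (hs.symm rs) (ht.symm bs) h2 h1
  have hb1 : f r₂ ≠ f b₁ := by rw [← hv2, hv1]; exact h1
  have hb2 : f r₁ ≠ f b₂ := by rw [← hv1, hv2]; exact h2
  have e11 := h.blue_of_not_red h1 (shift hs ht h1 h2)
  have e22 := h.blue_of_not_red h2 (shift (hs.symm rs) (ht.symm bs) h2 h1)
  have e12 := h.blue_of_not_red hb2 (shift hs (ht.symm bs) hb2 hb1)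
  have e21 := h.blue_of_not_red hb1 (shift (hs.symm rs) ht hb1 hb2)
  have vb1 := h.red_of_not_blue (hv1 ▸ h1) (attB ht)
  have vb2 := h.red_of_not_blue (hv2 ▸ h2) (attB (ht.symm bs))
  -- the ends of the red path have further neighbours on it
  obtain ⟨p, s', hs', hrp, rfl⟩ : ∃ p u, PathOn R p u r₂ ∧ R r₁ p ∧ s = {r₁} + u := by
    rcases hs.start_cases with ⟨rfl, rfl⟩ | h
    · exact (hno (.swap (.of_singleton_right v (.cons e11 ht) (by grind (ematch := 0))))).elim
    · exact h
  obtain ⟨p', s'', hs'', hrp', rfl⟩ : ∃ p' u, PathOn R p u p' ∧ R p' r₂ ∧ s' = {r₂} + u := by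
    rcases hs'.end_cases rs with ⟨rfl, rfl⟩ | h'
    · exact (h.red_ne hrp (hv1.symm.trans hv2)).elim
    · exact h'
  -- the red path without its ends
  have vp : B v p := by
    refine h.blue_of_not_red (hv1 ▸ h.red_ne hrp) fun e => hno ?_
    exact .of_paths (.cons e hs') (.cons e11 ht) (by grind (ematch := 0))
  have vp' : B v p' := by
    refine h.blue_of_not_red (hv2 ▸ (h.red_ne hrp').symm) fun e => hno ?_
    exact .of_paths (.cons e ((hs''.symm rs).snoc (rs hrp))) (.cons e21 ht) (by grind (ematch := 0))
  have vt : ∀ c ∈ t, f c ≠ f v → R v c := by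
    intro c hc hcv
    refine h.red_of_not_blue hcv.symm fun e => hno ?_
    obtain ⟨y, hy, -⟩ := (PathOn.cons e12 (ht.symm bs)).rotate bs (bs e11) (z := c) (by simp [hc])
    exact .of_paths hs' (.cons e hy) (by grind (ematch := 0))
  have pt : ∀ c ∈ t, f c ≠ f p → R p c := by
    intro c hc hcp
    refine h.red_of_not_blue hcp.symm fun e => hno ?_
    obtain ⟨y, hy, -⟩ := (PathOn.cons e12 (ht.symm bs)).rotate bs (bs e11) (z := c) (by simp [hc])
    rcases hs''.start_cases with ⟨rfl, rfl⟩ | ⟨p₂, u, hu, e', rfl⟩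
    · exact .of_paths (.single r₂) (.cons vp (.cons e hy)) (by grind (ematch := 0))
    · exact .of_paths (hu.snoc hrp') (.cons vp (.cons e hy)) (by grind (ematch := 0))
  have ht' : ∀ c ∈ t, f c = f v ∨ f c = f p := by
    intro c hc
    by_contra! hcc
    obtain h | ⟨x, y, u, hu, -, -, h⟩ :=
      (PathOn.cons e12 (ht.symm bs)).remove bs (bs e11) (z := c) (by simp [hc])
    · have := congrArg Multiset.card h
      simp [ht.ne_zero] at this
    · exact hno (.of_paths (.cons (vt c hc hcc.1) (.cons (rs (pt c hc hcc.2)) hs')) hu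
        (by grind (ematch := 0)))
  have b1p : f b₁ = f p := (ht' b₁ ht.start_mem).resolve_left (hv1 ▸ h1.symm)
  have r2p : R p r₂ := by
    refine h.red_of_not_blue (fun e => h.red_ne hrp (hv1 ▸ hv2 ▸ e.symm)) fun e => hno ?_
    rcases hs''.start_cases with ⟨rfl, rfl⟩ | ⟨p₂, u, hu, e', rfl⟩
    · exact .swap (.of_path (.cons vp (.cons e ((PathOn.cons e21 ht).snoc (bs e12)))) (by grind (ematch := 0)))
    · exact .of_paths hu (.cons vp (.cons e ((PathOn.cons e21 ht).snoc (bs e12)))) (by grind (ematch := 0))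
  have r1p' : R p' r₁ := by
    refine h.red_of_not_blue (fun e => h.red_ne hrp' (hv2 ▸ hv1 ▸ e)) fun e => hno ?_
    rcases hs''.end_cases rs with ⟨rfl, rfl⟩ | ⟨p₂, u, hu, e', rfl⟩
    · exact .swap (.of_path (.cons vp' (.cons e ((PathOn.cons e11 ht).snoc (bs e22)))) (by grind (ematch := 0)))
    · exact .of_paths hu (.cons vp' (.cons e ((PathOn.cons e11 ht).snoc (bs e22)))) (by grind (ematch := 0))
  have redr : ∀ x ∈ s'', f x ≠ f v → B v x → R r₁ x ∧ R r₂ x := by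
    intro x hx hxv e
    refine ⟨h.red_of_not_blue (hv1 ▸ hxv.symm) fun e' => hno ?_,
      h.red_of_not_blue (hv2 ▸ hxv.symm) fun e' => hno ?_⟩
    · obtain h | ⟨y, z, u, hu, -, -, h⟩ := hs'.remove rs (rs r2p) (z := x) (by simp [hx])
      · exact .swap (.of_path (.cons e (.cons (bs e') (.cons e11 ht))) (by grind (ematch := 0)))
      · exact .of_paths hu (.cons e (.cons (bs e') (.cons e11 ht))) (by grind (ematch := 0))
    · obtain h | ⟨y, z, u, hu, -, -, h⟩ :=
        (PathOn.cons hrp hs'').remove rs r1p' (z := x) (by simp [hx])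
      · exact .swap (.of_path (.cons e (.cons (bs e') (.cons e21 ht))) (by grind (ematch := 0)))
      · exact .of_paths hu (.cons e (.cons (bs e') (.cons e21 ht))) (by grind (ematch := 0))
  rcases hs''.slack_or_card_le (f v) with ⟨x, y, u, w, hu, hxy, hw, rfl, hx, hy⟩ | hcs
  · by_cases vx : R v x
    · by_cases vy : R v y
      · exact hno (.of_paths (.cons hrp (((hu.snoc (rs vx)).append vy hw).snoc hrp')) ht
          (by grind (ematch := 0)))
      · have ry := (redr y (by simp [hw.start_mem]) hy (h.blue_of_not_red hy.symm vy)).1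
        exact hno (.of_paths
          (.cons vx (((hu.symm rs).snoc (rs hrp)).append ry (hw.snoc hrp'))) ht (by grind (ematch := 0)))
    · have rx := redr x (by simp [hu.end_mem]) hx (h.blue_of_not_red hx.symm vx)
      by_cases vy : R v y
      · exact hno (.of_paths
          (.cons vy ((hw.snoc hrp').append rx.2 ((hu.symm rs).snoc (rs hrp)))) ht (by grind (ematch := 0)))
      · have ry := redr y (by simp [hw.start_mem]) hy (h.blue_of_not_red hy.symm vy)
        have hZ : PathOn R p ((u + {r₁}) + (w + {r₂})) r₂ :=
          (hu.snoc (rs rx.1)).append ry.1 (hw.snoc hrp')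
        have vZ : ∀ z ∈ (u + {r₁}) + (w + {r₂}), ¬ R v z := by
          intro z hz e
          obtain ⟨y, hy, -⟩ := hZ.rotate rs (rs r2p) hz
          rcases ht.start_cases with ⟨rfl, rfl⟩ | ⟨b, t', ht₀, -, rfl⟩
          · exact hno (.of_path (.cons (rs vb1) (.cons e hy)) (by grind (ematch := 0)))
          · exact hno (.of_paths (.cons (rs vb1) (.cons e hy)) ht₀ (by grind (ematch := 0)))
        obtain ⟨z, hz, hzv, hzp⟩ := hm.third (f v) (f p)
        have hz' : z ∈ (u + {r₁}) + (w + {r₂}) := by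
          have : z ∉ t := fun hzt => (ht' z hzt).elim hzv hzp
          have : z ≠ v := fun hzt => hzv (hzt ▸ rfl)
          simp [← hst] at hz ⊢
          tauto
        have vz := h.blue_of_not_red hzv.symm (vZ z hz')
        by_cases e : R b₁ z
        · obtain ⟨y, hy, -⟩ := hZ.rotate rs (rs r2p) hz'
          rcases ht.start_cases with ⟨rfl, rfl⟩ | ⟨b, t', ht₀, -, rfl⟩
          · exact hno (.of_path (.cons vb1 (.cons e hy)) (by grind (ematch := 0)))
          · exact hno (.of_paths (.cons vb1 (.cons e hy)) ht₀ (by grind (ematch := 0)))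
        · have e := h.blue_of_not_red (b1p ▸ hzp.symm) e
          obtain h | ⟨x, y, u, hu, -, -, h⟩ := hZ.remove rs (rs r2p) hz'
          · exact hno (.swap (.of_path (.cons vz (.cons (bs e) ht)) (by grind (ematch := 0))))
          · exact hno (.of_paths hu (.cons vz (.cons (bs e) ht)) (by grind (ematch := 0)))
  · rcases ht.slack_or_card_le (f v) with ⟨x, y, u, w, hu, hxy, hw, rfl, hx, hy⟩ | hct
    · have hx' := (ht' x (by simp [hu.end_mem])).resolve_left hx
      have hy' := (ht' y (by simp [hw.start_mem])).resolve_left hy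
      exact h.blue_ne hxy (hx'.trans hy'.symm)
    · have := hm.fair (f v)
      simp only [← hst, Multiset.card_cons, ← hv1, ← hv2,
        Multiset.card_add, Multiset.countP_add, Multiset.countP_cons, if_true, ← Multiset.cons_zero,
        Multiset.card_zero, Multiset.countP_zero, Multiset.cons_add] at this
      split_ifs at * <;> omega
end TwoColouring

namespace TwoColouring
variable {V κ : Type*} [DecidableEq κ] {f : V → κ} {R B : V → V → Prop} {m : Multiset V}

theorem splits_of_matched (h : TwoColouring f R B) (hm : Fair f m) {v r₁ r₂ b₁ b₂ : V}
    {s t : Multiset V} (hs : PathOn R r₁ s r₂) (ht : PathOn B b₁ t b₂) (hst : s + t + {v} = m)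
    (h1 : f r₁ ≠ f b₁) (h2 : f r₂ ≠ f b₂) : Splits R B m :=
  splits_of_matched_aux h hm _ hs ht hst h1 h2 rfl

theorem splits_of_three_ends (h : TwoColouring f R B) (hm : Fair f m) {v r₁ r₂ b₁ b₂ : V}
    {s t : Multiset V} (hs : PathOn R r₁ s r₂) (ht : PathOn B b₁ t b₂) (hst : s + t + {v} = m)
    (h1 : f b₁ = f r₁) (h2 : f b₂ = f r₁) (hr : f r₂ ≠ f r₁) (hv : f v ≠ f r₁) :
    Splits R B m := by
  by_contra hno
  have rs : ∀ {x y}, R x y → R y x := h.red_symm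
  have bs : ∀ {x y}, B x y → B y x := h.blue_symm
  have vb1 : R v b₁ := by
    refine h.red_of_not_blue (h1 ▸ hv) fun e => hno ?_
    exact .of_paths hs (.cons e ht) (by grind (ematch := 0))
  have vb2 : R v b₂ := by
    refine h.red_of_not_blue (h2 ▸ hv) fun e => hno ?_
    exact .of_paths hs (.cons e (ht.symm bs)) (by grind (ematch := 0))
  have shift : ∀ {r₁ r₂ b₁ b₂ : V}, PathOn R r₁ s r₂ → PathOn B b₁ t b₂ → R v b₁ → f r₁ ≠ f b₁ →
      B r₁ b₁ := by
    intro r₁ r₂ b₁ b₂ hs ht h1 h2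
    refine h.blue_of_not_red h2 fun hr => ?_
    rcases ht.start_cases with ⟨rfl, rfl⟩ | ⟨y, u, hu, e, rfl⟩
    · exact hno (.of_path (.cons h1 (.cons (rs hr) hs)) (by grind (ematch := 0)))
    · exact hno (.of_paths (.cons h1 (.cons (rs hr) hs)) hu (by grind (ematch := 0)))
  have key : ∀ {r₁ r₂ : V}, PathOn R r₁ s r₂ → f r₂ ≠ f b₁ → f r₂ = f v := by
    intro r₁ r₂ hs hr
    by_contra hv
    have e1 := shift (hs.symm rs) ht vb1 hr
    have e2 : B v r₂ := by
      refine h.blue_of_not_red (Ne.symm hv) fun e => hno ?_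
      exact .of_paths (.cons e (hs.symm rs)) ht (by grind (ematch := 0))
    rcases hs.end_cases rs with ⟨rfl, rfl⟩ | ⟨y, u, hu, e, rfl⟩
    · exact hno (.swap (.of_path (.cons e2 (.cons e1 ht)) (by grind (ematch := 0))))
    · exact hno (.of_paths hu (.cons e2 (.cons e1 ht)) (by grind (ematch := 0)))
  have rv := key hs (h1 ▸ hr)
  have e1 := shift (hs.symm rs) ht vb1 (h1 ▸ hr)
  have e2 := shift (hs.symm rs) (ht.symm bs) vb2 (h2 ▸ hr)
  have vr1 : B v r₁ := by
    refine h.blue_of_not_red hv fun e => hno ?_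
    exact .of_paths (.cons e hs) ht (by grind (ematch := 0))
  have hC := PathOn.cons e1 ht
  obtain ⟨p, s', hs', hrp, rfl⟩ : ∃ p u, PathOn R r₁ u p ∧ R p r₂ ∧ s = {r₂} + u := by
    rcases hs.end_cases rs with ⟨rfl, rfl⟩ | h
    · exact (hr rfl).elim
    · exact h
  have rC : ∀ c ∈ {r₂} + t, f c ≠ f r₁ → R r₁ c := by
    intro c hc hcr
    refine h.red_of_not_blue hcr.symm fun e => hno ?_
    obtain ⟨y, hy, -⟩ := hC.rotate bs (bs e2) hc
    rcases hs'.start_cases with ⟨rfl, rfl⟩ | ⟨z, u, hu, e', rfl⟩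
    · exact .swap (.of_path (.cons vr1 (.cons e hy)) (by grind (ematch := 0)))
    · exact .of_paths hu (.cons vr1 (.cons e hy)) (by grind (ematch := 0))
  have hR : ∀ x ∈ {r₂} + s', f x = f r₁ ∨ f x = f v := by
    intro x hx
    by_contra! hxx
    obtain ⟨y, hy, -⟩ := hs.rotate rs (rs (rC r₂ (by simp) hr)) hx
    by_cases hyq : f y = f r₁
    · exact hxx.2 (key (hy.symm rs) (h1 ▸ hxx.1))
    · exact hno (h.splits_of_matched hm hy ht hst (h1 ▸ hxx.1) (h2 ▸ hyq))
  obtain ⟨c, hc, hcr, hcv⟩ := hm.third (f r₁) (f v)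
  have hct : c ∈ {r₂} + t := by
    have hcs : c ∉ {r₂} + s' := fun hx => (hR c hx).elim hcr hcv
    have : c ≠ v := fun hx => hcv (hx ▸ rfl)
    simp [← hst] at hc hcs ⊢
    tauto
  by_cases e : R v c
  · obtain hl | ⟨x, y, u, hu, -, -, hl⟩ := hC.remove bs (bs e2) hct
    · exact hno (.of_path (.cons e (.cons (rs (rC c hct hcr)) hs')) (by grind (ematch := 0)))
    · exact hno (.of_paths (.cons e (.cons (rs (rC c hct hcr)) hs')) hu (by grind (ematch := 0)))
  · obtain ⟨y, hy, -⟩ := hC.rotate bs (bs e2) hct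
    exact hno (.of_paths hs' (.cons (h.blue_of_not_red hcv.symm e) hy) (by grind (ematch := 0)))

end TwoColouring

/-- The positions of the four ends of the two paths, and of a single uncovered vertex, for which
that vertex cannot necessarily be absorbed: three ends and the vertex, or all four ends, are in
the same class. -/
def Blocked {κ : Type*} (α₁ α₂ β₁ β₂ ν : κ) : Prop :=
  (α₁ = α₂ ∧ α₁ = β₁ ∧ α₁ = β₂) ∨ (ν = α₁ ∧ ν = β₁ ∧ ν = β₂) ∨ (ν = α₂ ∧ ν = β₁ ∧ ν = β₂) ∨
    (ν = β₁ ∧ ν = α₁ ∧ ν = α₂) ∨ (ν = β₂ ∧ ν = α₁ ∧ ν = α₂)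

instance {κ : Type*} [DecidableEq κ] (α₁ α₂ β₁ β₂ ν : κ) : Decidable (Blocked α₁ α₂ β₁ β₂ ν) :=
  inferInstanceAs (Decidable (_ ∨ _))

namespace Blocked
variable {κ : Type*} {α₁ α₂ β₁ β₂ ν : κ}

theorem symm_red (h : Blocked α₁ α₂ β₁ β₂ ν) : Blocked α₂ α₁ β₁ β₂ ν := by grind [Blocked]

theorem symm_blue (h : Blocked α₁ α₂ β₁ β₂ ν) : Blocked α₁ α₂ β₂ β₁ ν := by grind [Blocked]

theorem swap (h : Blocked α₁ α₂ β₁ β₂ ν) : Blocked β₁ β₂ α₁ α₂ ν := by grind [Blocked]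

theorem ends_eq (h : Blocked α₁ α₂ β₁ β₂ ν) (hne : α₁ ≠ ν) : α₂ = β₂ ∧ (α₂ = α₁ ∨ α₂ = ν) := by
  grind [Blocked]

theorem ends_eq_of_ne (h : Blocked α₁ α₂ β₁ β₂ ν) (hne : α₁ ≠ ν) (hβ : β₁ ≠ ν) :
    α₂ = α₁ ∧ β₂ = α₁ := by
  grind [Blocked]

end Blocked

/-- If a vertex of class `η` cannot be inserted between two ends, these are the possible positions
of the ends of the two paths. -/
def NoAbsorb (η ζ α₁ α₂ β₁ β₂ : Fin 3) : Prop :=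
  (η ≠ α₁ → η ≠ β₁ → α₁ ≠ β₁ → α₂ = β₂ ∧ (α₂ = η ∨ α₂ = ζ)) ∧
  (η ≠ α₁ → η ≠ β₂ → α₁ ≠ β₂ → α₂ = β₁ ∧ (α₂ = η ∨ α₂ = ζ)) ∧
  (η ≠ α₂ → η ≠ β₁ → α₂ ≠ β₁ → α₁ = β₂ ∧ (α₁ = η ∨ α₁ = ζ)) ∧
  (η ≠ α₂ → η ≠ β₂ → α₂ ≠ β₂ → α₁ = β₁ ∧ (α₁ = η ∨ α₁ = ζ))

/-- If an edge between the classes `η` and `ζ` cannot be attached to the ends, these are the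
possible positions of the ends of the two paths. -/
def NoAttach (η ζ α₁ α₂ β₁ β₂ : Fin 3) : Prop :=
  (β₁ = ζ → α₁ = η → α₂ = η ∧ β₂ = η) ∧ (β₂ = ζ → α₁ = η → α₂ = η ∧ β₁ = η) ∧
  (β₁ = ζ → α₂ = η → α₁ = η ∧ β₂ = η) ∧ (β₂ = ζ → α₂ = η → α₁ = η ∧ β₁ = η)

set_option synthInstance.maxSize 1000 in
set_option synthInstance.maxHeartbeats 200000 in
instance (η ζ α₁ α₂ β₁ β₂ : Fin 3) : Decidable (NoAbsorb η ζ α₁ α₂ β₁ β₂) := by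
  unfold NoAbsorb; infer_instance

set_option synthInstance.maxSize 1000 in
set_option synthInstance.maxHeartbeats 200000 in
instance (η ζ α₁ α₂ β₁ β₂ : Fin 3) : Decidable (NoAttach η ζ α₁ α₂ β₁ β₂) := by
  unfold NoAttach; infer_instance

set_option maxRecDepth 10000 in
theorem pair_ends_impossible : ∀ η ζ α₁ α₂ β₁ β₂ : Fin 3, η ≠ ζ → ¬ Blocked α₁ α₂ β₁ β₂ η →
    ¬ Blocked α₁ α₂ β₁ β₂ ζ → NoAbsorb η ζ α₁ α₂ β₁ β₂ → NoAbsorb ζ η α₁ α₂ β₁ β₂ →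
    NoAttach η ζ α₁ α₂ β₁ β₂ → NoAttach ζ η α₁ α₂ β₁ β₂ → False := by
  decide

namespace TwoColouring
section
variable {V κ : Type*} [DecidableEq κ] {f : V → κ} {R B : V → V → Prop} {m : Multiset V}

theorem splits_of_single (h : TwoColouring f R B) (hm : Fair f m) {v r₁ r₂ b₁ b₂ : V}
    {s t : Multiset V} (hs : PathOn R r₁ s r₂) (ht : PathOn B b₁ t b₂) (hst : s + t + {v} = m)
    (hb : ¬ Blocked (f r₁) (f r₂) (f b₁) (f b₂) (f v)) : Splits R B m := by
  have hst' : t + s + {v} = m := by rw [add_comm t, hst]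
  have hs' := hs.symm h.red_symm
  have ht' := ht.symm h.blue_symm
  by_cases h1 : f r₁ ≠ f b₁ ∧ f r₂ ≠ f b₂
  · exact h.splits_of_matched hm hs ht hst h1.1 h1.2
  by_cases h2 : f r₁ ≠ f b₂ ∧ f r₂ ≠ f b₁
  · exact h.splits_of_matched hm hs ht' hst h2.1 h2.2
  by_cases h3 : f b₁ = f r₁ ∧ f b₂ = f r₁
  · by_cases h4 : f r₂ = f r₁
    · grind [Blocked]
    · exact h.splits_of_three_ends hm hs ht hst h3.1 h3.2 h4 (by grind [Blocked])
  by_cases h4 : f b₁ = f r₂ ∧ f b₂ = f r₂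
  · exact h.splits_of_three_ends hm hs' ht hst h4.1 h4.2 (by grind [Blocked]) (by grind [Blocked])
  by_cases h5 : f r₁ = f b₁ ∧ f r₂ = f b₁
  · exact (h.swap.splits_of_three_ends hm ht hs hst' h5.1 h5.2 (by grind) (by grind [Blocked])).swap
  · exact (h.swap.splits_of_three_ends hm ht' hs hst' (by grind) (by grind) (by grind)
      (by grind [Blocked])).swap

end

variable {V : Type*} {f : V → Fin 3} {R B : V → V → Prop} {m : Multiset V}

theorem splits_of_pair_aux (h : TwoColouring f R B) (hm : Fair f m) {y z r₁ r₂ b₁ b₂ : V}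
    {s t : Multiset V} (hs : PathOn R r₁ s r₂) (ht : PathOn B b₁ t b₂)
    (hst : s + t + {y} + {z} = m) (hyz : B y z)
    (hy : ¬ Blocked (f r₁) (f r₂) (f b₁) (f b₂) (f y))
    (hz : ¬ Blocked (f r₁) (f r₂) (f b₁) (f b₂) (f z)) : Splits R B m := by
  by_contra hno
  have rs : ∀ {x y}, R x y → R y x := h.red_symm
  have bs : ∀ {x y}, B x y → B y x := h.blue_symm
  have hne : f y ≠ f z := h.blue_ne hyz
  have attR : ∀ {r₁ r₂ y z : V}, PathOn R r₁ s r₂ → s + t + {y} + {z} = m → f y ≠ f z →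
      ¬ Blocked (f r₁) (f r₂) (f b₁) (f b₂) (f y) → ¬ Blocked (f r₁) (f r₂) (f b₁) (f b₂) (f z) →
      f y ≠ f r₁ → B y r₁ := by
    intro r₁ r₂ y z hs hst hne h1 h2 hr
    refine h.blue_of_not_red hr fun e => hno ?_
    exact h.splits_of_single hm (.cons e hs) ht (v := z) (by grind (ematch := 0))
      fun hb => by clear * - hb h1 h2 hne; grind [Blocked]
  have attB : ∀ {b₁ b₂ y z : V}, PathOn B b₁ t b₂ → s + t + {y} + {z} = m → f y ≠ f z →
      ¬ Blocked (f r₁) (f r₂) (f b₁) (f b₂) (f y) → ¬ Blocked (f r₁) (f r₂) (f b₁) (f b₂) (f z) →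
      f y ≠ f b₁ → R y b₁ := by
    intro b₁ b₂ y z ht hst hne h1 h2 hr
    refine h.red_of_not_blue hr fun e => hno ?_
    exact h.splits_of_single hm hs (.cons e ht) (v := z) (by grind (ematch := 0))
      fun hb => by clear * - hb h1 h2 hne; grind [Blocked]
  have hst' : s + t + {z} + {y} = m := by grind (ematch := 0)
  have hs' := hs.symm rs
  have ht' := ht.symm bs
  have y₁ := attR hs hst hne hy hz
  have y₂ := attR hs' hst hne (mt Blocked.symm_red hy) (mt Blocked.symm_red hz)
  have z₁ := attR hs hst' hne.symm hz hy
  have z₂ := attR hs' hst' hne.symm (mt Blocked.symm_red hz) (mt Blocked.symm_red hy)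
  have y₃ := attB ht hst hne hy hz
  have y₄ := attB ht' hst hne (mt Blocked.symm_blue hy) (mt Blocked.symm_blue hz)
  have z₃ := attB ht hst' hne.symm hz hy
  have z₄ := attB ht' hst' hne.symm (mt Blocked.symm_blue hz) (mt Blocked.symm_blue hy)
  -- absorbing `x` at two ends in the classes other than that of `x`
  have absorb : ∀ {x x' r₁ r₂ b₁ b₂ : V}, PathOn R r₁ s r₂ → PathOn B b₁ t b₂ →
      s + t + {x} + {x'} = m → B x r₁ → R x b₁ → f r₁ ≠ f b₁ → f x ≠ f x' →
      f r₂ = f b₂ ∧ (f r₂ = f x ∨ f r₂ = f x') := by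
    intro x x' r₁ r₂ b₁ b₂ hs ht hst e1 e2 hr hne
    by_contra hc
    rcases h.total hr with e | e
    · rcases ht.start_cases with ⟨rfl, rfl⟩ | ⟨p, u, hu, e', rfl⟩
      · exact hno (.of_singleton_right x' (.cons e2 (.cons (rs e) hs)) (by grind (ematch := 0)))
      · exact hno (h.splits_of_single hm (.cons e2 (.cons (rs e) hs)) hu (v := x')
          (by grind (ematch := 0)) fun hb => hc (hb.ends_eq hne))
    · rcases hs.start_cases with ⟨rfl, rfl⟩ | ⟨p, u, hu, e', rfl⟩
      · exact hno (.swap (.of_singleton_right x' (.cons e1 (.cons e ht)) (by grind (ematch := 0))))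
      · exact hno (h.splits_of_single hm hu (.cons e1 (.cons e ht)) (v := x')
          (by grind (ematch := 0)) fun hb => hc (hb.swap.ends_eq hne |>.imp Eq.symm fun h => by
            rwa [hb.swap.ends_eq hne |>.1] at h))
  have final : ∀ {y z r₁ r₂ b₁ b₂ : V}, PathOn R r₁ s r₂ → PathOn B b₁ t b₂ →
      s + t + {y} + {z} = m → B y z → B z r₁ → R y b₁ → f b₁ = f z → f r₁ = f y →
      f r₂ = f y ∧ f b₂ = f y := by
    intro y z r₁ r₂ b₁ b₂ hs ht hst hyz e1 e2 hbz hr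
    by_contra hc
    rcases h.total (x := r₁) (y := b₁) (by rw [hbz, hr]; exact h.blue_ne hyz) with e | e
    · rcases ht.start_cases with ⟨rfl, rfl⟩ | ⟨p, u, hu, e', rfl⟩
      · exact hno (.of_singleton_right z (.cons e2 (.cons (rs e) hs)) (by grind (ematch := 0)))
      · have hp := h.blue_ne e'
        exact hno (h.splits_of_single hm (.cons e2 (.cons (rs e) hs)) hu (v := z)
          (by grind (ematch := 0)) fun hb => hc (hb.ends_eq_of_ne (h.blue_ne hyz) (hbz ▸ hp.symm)))
    · rcases hs.start_cases with ⟨rfl, rfl⟩ | ⟨p, u, hu, e', rfl⟩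
      · exact hno (.swap (.of_path (.cons hyz (.cons e1 (.cons e ht))) (by grind (ematch := 0))))
      · exact hno (.of_paths hu (.cons hyz (.cons e1 (.cons e ht))) (by grind (ematch := 0)))
  refine pair_ends_impossible (f y) (f z) (f r₁) (f r₂) (f b₁) (f b₂) hne hy hz
    ⟨fun e1 e2 e3 => absorb hs ht hst (y₁ e1) (y₃ e2) e3 hne,
      fun e1 e2 e3 => absorb hs ht' hst (y₁ e1) (y₄ e2) e3 hne,
      fun e1 e2 e3 => absorb hs' ht hst (y₂ e1) (y₃ e2) e3 hne,
      fun e1 e2 e3 => absorb hs' ht' hst (y₂ e1) (y₄ e2) e3 hne⟩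
    ⟨fun e1 e2 e3 => absorb hs ht hst' (z₁ e1) (z₃ e2) e3 hne.symm,
      fun e1 e2 e3 => absorb hs ht' hst' (z₁ e1) (z₄ e2) e3 hne.symm,
      fun e1 e2 e3 => absorb hs' ht hst' (z₂ e1) (z₃ e2) e3 hne.symm,
      fun e1 e2 e3 => absorb hs' ht' hst' (z₂ e1) (z₄ e2) e3 hne.symm⟩
    ⟨fun e1 e2 => final hs ht hst hyz (z₁ (e2 ▸ hne.symm)) (y₃ (e1 ▸ hne)) e1 e2,
      fun e1 e2 => final hs ht' hst hyz (z₁ (e2 ▸ hne.symm)) (y₄ (e1 ▸ hne)) e1 e2,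
      fun e1 e2 => final hs' ht hst hyz (z₂ (e2 ▸ hne.symm)) (y₃ (e1 ▸ hne)) e1 e2,
      fun e1 e2 => final hs' ht' hst hyz (z₂ (e2 ▸ hne.symm)) (y₄ (e1 ▸ hne)) e1 e2⟩
    ⟨fun e1 e2 => final hs ht hst' (bs hyz) (y₁ (e2 ▸ hne)) (z₃ (e1 ▸ hne.symm)) e1 e2,
      fun e1 e2 => final hs ht' hst' (bs hyz) (y₁ (e2 ▸ hne)) (z₄ (e1 ▸ hne.symm)) e1 e2,
      fun e1 e2 => final hs' ht hst' (bs hyz) (y₂ (e2 ▸ hne)) (z₃ (e1 ▸ hne.symm)) e1 e2,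
      fun e1 e2 => final hs' ht' hst' (bs hyz) (y₂ (e2 ▸ hne)) (z₄ (e1 ▸ hne.symm)) e1 e2⟩

theorem splits_of_pair (h : TwoColouring f R B) (hm : Fair f m) {y z r₁ r₂ b₁ b₂ : V}
    {s t : Multiset V} (hs : PathOn R r₁ s r₂) (ht : PathOn B b₁ t b₂)
    (hst : s + t + {y} + {z} = m) (hyz : f y ≠ f z)
    (hy : ¬ Blocked (f r₁) (f r₂) (f b₁) (f b₂) (f y))
    (hz : ¬ Blocked (f r₁) (f r₂) (f b₁) (f b₂) (f z)) : Splits R B m := by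
  rcases h.total hyz with e | e
  · exact (h.swap.splits_of_pair_aux hm ht hs (by rw [add_comm t, hst]) e
      (mt Blocked.swap hy) (mt Blocked.swap hz)).swap
  · exact h.splits_of_pair_aux hm hs ht hst e hy hz

end TwoColouring

namespace TwoColouring
variable {V : Type*} {f : V → Fin 3} {R B : V → V → Prop} {m : Multiset V}

theorem splits_of_triple_matched (h : TwoColouring f R B) (hm : Fair f m)
    {u v x r₁ r₂ b₁ b₂ : V} {s t : Multiset V} (hs : PathOn R r₁ s r₂) (ht : PathOn B b₁ t b₂)
    (hst : s + t + {u} + {v} + {x} = m) (hu : f u = f r₁) (hv : f v = f b₁)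
    (hxu : f x ≠ f u) (hxv : f x ≠ f v) (h1 : f r₁ ≠ f b₁) (h2 : f r₂ ≠ f b₂) :
    Splits R B m := by
  have huv : f u ≠ f v := by rwa [hu, hv]
  rcases h.total (hu ▸ hxu) with e1 | e1
  · exact h.splits_of_pair hm (.cons e1 hs) ht (y := u) (z := v) (by grind (ematch := 0)) huv
      (by clear * - hu hv hxu hxv h1 h2; grind [Blocked])
      (by clear * - hu hv hxu hxv h1 h2; grind [Blocked])
  rcases h.total (hv ▸ hxv) with e2 | e2
  swap
  · exact h.splits_of_pair hm hs (.cons e2 ht) (y := u) (z := v) (by grind (ematch := 0)) huv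
      (by clear * - hu hv hxu hxv h1 h2; grind [Blocked])
      (by clear * - hu hv hxu hxv h1 h2; grind [Blocked])
  rcases h.total h1 with e | e
  · have hs' := PathOn.cons e2 (.cons (h.red_symm e) hs)
    rcases ht.start_cases with ⟨rfl, rfl⟩ | ⟨y, t', ht', e', rfl⟩
    · exact h.splits_of_single hm hs' (.single u) (v := v) (by grind (ematch := 0))
        (by clear * - hu hv hxu hxv h1 h2; grind [Blocked])
    · have := h.blue_ne e'
      exact h.splits_of_pair hm hs' ht' (y := u) (z := v) (by grind (ematch := 0)) huv
        (by clear * - hu hv hxu hxv h1 h2 this; grind [Blocked])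
        (by clear * - hu hv hxu hxv h1 h2 this; grind [Blocked])
  · have ht' := PathOn.cons e1 (.cons e ht)
    rcases hs.start_cases with ⟨rfl, rfl⟩ | ⟨y, s', hs', e', rfl⟩
    · exact h.splits_of_single hm (.single u) ht' (v := v) (by grind (ematch := 0))
        (by clear * - hu hv hxu hxv h1 h2; grind [Blocked])
    · have := h.red_ne e'
      exact h.splits_of_pair hm hs' ht' (y := u) (z := v) (by grind (ematch := 0)) huv
        (by clear * - hu hv hxu hxv h1 h2 this; grind [Blocked])
        (by clear * - hu hv hxu hxv h1 h2 this; grind [Blocked])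

theorem splits_of_triple_three_ends (h : TwoColouring f R B) (hm : Fair f m)
    {u v w r₁ r₂ b₁ b₂ : V} {s t : Multiset V} (hs : PathOn R r₁ s r₂) (ht : PathOn B b₁ t b₂)
    (hst : s + t + {u} + {v} + {w} = m) (h1 : f r₁ = f u) (h2 : f r₂ = f u) (h3 : f b₁ = f u)
    (h4 : f b₂ = f v) (huv : f u ≠ f v) (huw : f u ≠ f w) (hvw : f v ≠ f w) :
    Splits R B m := by
  by_contra hno
  have rs : ∀ {x y}, R x y → R y x := h.red_symm
  have bs : ∀ {x y}, B x y → B y x := h.blue_symm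
  have vr : ∀ {r₁ r₂}, PathOn R r₁ s r₂ → f r₁ = f u → f r₂ = f u → B v r₁ := by
    intro r₁ r₂ hs h1 h2
    refine h.blue_of_not_red (h1 ▸ huv.symm) fun e => hno ?_
    exact h.splits_of_pair hm (.cons e hs) ht (y := u) (z := w) (by grind (ematch := 0)) huw
      (by clear * - h1 h2 h3 h4 huv huw hvw; grind [Blocked])
      (by clear * - h1 h2 h3 h4 huv huw hvw; grind [Blocked])
  have wr : ∀ {r₁ r₂}, PathOn R r₁ s r₂ → f r₁ = f u → f r₂ = f u → B w r₁ := by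
    intro r₁ r₂ hs h1 h2
    refine h.blue_of_not_red (h1 ▸ huw.symm) fun e => hno ?_
    exact h.splits_of_pair hm (.cons e hs) ht (y := u) (z := v) (by grind (ematch := 0)) huv
      (by clear * - h1 h2 h3 h4 huv huw hvw; grind [Blocked])
      (by clear * - h1 h2 h3 h4 huv huw hvw; grind [Blocked])
  have vb : R v b₁ := by
    refine h.red_of_not_blue (h3 ▸ huv.symm) fun e => hno ?_
    exact h.splits_of_pair hm hs (.cons e ht) (y := u) (z := w) (by grind (ematch := 0)) huw
      (by clear * - h1 h2 h3 h4 huv huw hvw; grind [Blocked])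
      (by clear * - h1 h2 h3 h4 huv huw hvw; grind [Blocked])
  have wb : R w b₁ := by
    refine h.red_of_not_blue (h3 ▸ huw.symm) fun e => hno ?_
    exact h.splits_of_pair hm hs (.cons e ht) (y := u) (z := v) (by grind (ematch := 0)) huv
      (by clear * - h1 h2 h3 h4 huv huw hvw; grind [Blocked])
      (by clear * - h1 h2 h3 h4 huv huw hvw; grind [Blocked])
  have wb₂ : R w b₂ := by
    refine h.red_of_not_blue (h4 ▸ hvw.symm) fun e => hno ?_
    have ht' := ((ht.snoc (bs e)).snoc (wr hs h1 h2)).snoc (bs (vr hs h1 h2))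
    rcases hs.start_cases with ⟨rfl, rfl⟩ | ⟨y, s', hs', e', rfl⟩
    · exact .swap (.of_singleton_right u ht' (by grind (ematch := 0)))
    · have := h.red_ne e'
      exact h.splits_of_single hm hs' ht' (v := u) (by grind (ematch := 0))
        (by clear * - h1 h2 h3 h4 huv huw hvw this; grind [Blocked])
  have hr : f r₁ ≠ f b₂ := by rwa [h1, h4]
  rcases h.total hr with e | e
  · have hs' := PathOn.cons wb₂ (.cons (rs e) hs)
    rcases ht.end_cases bs with ⟨rfl, rfl⟩ | ⟨y, t', ht', e', rfl⟩
    · exact huv (h3.symm.trans h4)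
    by_cases hy : f y = f u
    · have hs'' := PathOn.cons vb (.cons (rs wb) hs')
      rcases ht'.start_cases with ⟨rfl, rfl⟩ | ⟨x, t'', ht'', e'', rfl⟩
      · exact hno (.of_singleton_right u hs'' (by grind (ematch := 0)))
      · have := h.blue_ne e''
        exact hno (h.splits_of_single hm hs'' ht'' (v := u) (by grind (ematch := 0))
          (by clear * - h1 h2 h3 h4 huv huw hvw this hy; grind [Blocked]))
    · exact hno (h.splits_of_pair hm hs' ht' (y := u) (z := v) (by grind (ematch := 0)) huv
        (by clear * - h1 h2 h3 h4 huv huw hvw hy; grind [Blocked])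
        (by clear * - h1 h2 h3 h4 huv huw hvw hy; grind [Blocked]))
  · have ht' := PathOn.cons e (ht.symm bs)
    rcases hs.start_cases with ⟨rfl, rfl⟩ | ⟨y, s', hs', e', rfl⟩
    · exact hno (h.splits_of_pair hm (.single w) ht' (y := u) (z := v) (by grind (ematch := 0)) huv
        (by clear * - h1 h2 h3 h4 huv huw hvw; grind [Blocked])
        (by clear * - h1 h2 h3 h4 huv huw hvw; grind [Blocked]))
    · have := h.red_ne e'
      exact hno (h.splits_of_pair hm hs' (.cons (wr hs h1 h2) ht') (y := u) (z := v)
        (by grind (ematch := 0)) huv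
        (by clear * - h1 h2 h3 h4 huv huw hvw this; grind [Blocked])
        (by clear * - h1 h2 h3 h4 huv huw hvw this; grind [Blocked]))

theorem four_ends_attach (h : TwoColouring f R B) (hm : Fair f m)
    {u v w r₁ r₂ b₁ b₂ : V} {s t : Multiset V} (hs : PathOn R r₁ s r₂) (ht : PathOn B b₁ t b₂)
    (hst : s + t + {u} + {v} + {w} = m) (h2 : f r₂ = f u) (h3 : f b₁ = f u)
    (h4 : f b₂ = f u) (huv : f u ≠ f v) (huw : f u ≠ f w) (hno : ¬ Splits R B m)
    (e : R v r₁) : R w b₁ ∧ B v b₁ := by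
  have rs : ∀ {x y}, R x y → R y x := h.red_symm
  have bs : ∀ {x y}, B x y → B y x := h.blue_symm
  have wb : R w b₁ := by
    refine h.red_of_not_blue (h3 ▸ huw.symm) fun e' => hno ?_
    exact h.splits_of_single hm (.cons e hs) (.cons e' ht) (v := u) (by grind (ematch := 0))
      (by clear * - h2 h3 h4 huv huw; grind [Blocked])
  refine ⟨wb, h.blue_of_not_red (h3 ▸ huv.symm) fun e' => hno ?_⟩
  have hs' := PathOn.cons wb (.cons (rs e') (.cons e hs))
  rcases ht.start_cases with ⟨rfl, rfl⟩ | ⟨x, t', ht', e', rfl⟩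
  · exact .of_singleton_right u hs' (by grind (ematch := 0))
  · have := h.blue_ne e'
    exact h.splits_of_single hm hs' ht' (v := u) (by grind (ematch := 0))
      (by clear * - h2 h3 h4 huv huw this; grind [Blocked])

theorem splits_of_four_ends_slack (h : TwoColouring f R B) (hm : Fair f m)
    {u v w r₁ r₂ b₁ b₂ x y : V} {s s₁ s₂ t : Multiset V} (hs₁ : PathOn R r₁ s₁ x)
    (hs₂ : PathOn R y s₂ r₂) (hs : s = s₁ + s₂) (ht : PathOn B b₁ t b₂)
    (hst : s + t + {u} + {v} + {w} = m) (h3 : f b₁ = f u)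
    (h4 : f b₂ = f u) (huw : f u ≠ f w) (hx : f x ≠ f u) (hy : f y ≠ f u)
    (e₁ : R v r₁) (e₂ : R v r₂) : Splits R B m :=
  h.splits_of_pair hm (((hs₁.symm h.red_symm).snoc (h.red_symm e₁)).append e₂
    (hs₂.symm h.red_symm)) ht (y := u) (z := w) (by grind (ematch := 0)) huw
    (by clear * - h3 h4 huw hx hy; grind [Blocked])
    (by clear * - h3 h4 huw hx hy; grind [Blocked])

theorem splits_of_four_ends_attach (h : TwoColouring f R B) (hm : Fair f m)
    {u v w r₁ r₂ b₁ b₂ : V} {s t : Multiset V} (hs : PathOn R r₁ s r₂) (ht : PathOn B b₁ t b₂)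
    (hst : s + t + {u} + {v} + {w} = m) (h1 : f r₁ = f u) (h2 : f r₂ = f u) (h3 : f b₁ = f u)
    (h4 : f b₂ = f u) (huv : f u ≠ f v) (huw : f u ≠ f w)
    (e : R v r₁) : Splits R B m := by
  by_contra hno
  have rs : ∀ {x y}, R x y → R y x := h.red_symm
  have bs : ∀ {x y}, B x y → B y x := h.blue_symm
  have hst' : t + s + {u} + {v} + {w} = m := by rw [add_comm t, hst]
  have hno' : ¬ Splits B R m := mt Splits.swap hno
  obtain ⟨-, v1⟩ := h.four_ends_attach hm hs ht hst h2 h3 h4 huv huw hno e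
  obtain ⟨-, v2⟩ := h.four_ends_attach hm hs (ht.symm bs) hst h2 h4 h3 huv huw hno e
  obtain ⟨-, v3⟩ := h.swap.four_ends_attach hm ht (hs.symm rs) hst' h4 h2 h1 huv huw hno' v1
  rcases hs.slack_or_card_le (f u) with ⟨x, y, s₁, s₂, hs₁, -, hs₂, hs', hx, hy⟩ | hcs
  · exact hno (h.splits_of_four_ends_slack hm hs₁ hs₂ hs' ht hst h3 h4 huw hx hy e v3)
  rcases ht.slack_or_card_le (f u) with ⟨x, y, s₁, s₂, hs₁, -, hs₂, hs', hx, hy⟩ | hct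
  · exact hno' (h.swap.splits_of_four_ends_slack hm hs₁ hs₂ hs' hs hst' h1 h2 huw hx hy v1 v2)
  have := hm.fair (f u)
  simp only [← hst, ← Multiset.cons_zero, Multiset.card_add, Multiset.countP_add,
    Multiset.countP_cons, Multiset.card_cons, Multiset.card_zero, Multiset.countP_zero,
    if_true] at this
  simp only [h1, h2, h3, h4, if_true] at hcs hct
  omega

end TwoColouring

namespace TwoColouring
variable {V : Type*} {f : V → Fin 3} {R B : V → V → Prop} {m : Multiset V}

theorem splits_of_mixed_edges (h : TwoColouring f R B) (hm : Fair f m)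
    {u v w r s' p b b' : V} {s t : Multiset V} (hs : PathOn R s' s p) (e : R p r)
    (hsr : f s' ≠ f u) {r' : V} (ht : PathOn B b t b')
    (hst : ({r} + s + {r'}) + t + {u} + {v} + {w} = m) (h1 : f r = f u)
    (h3 : f b = f u) (h4 : f b' = f u) (huw : f u ≠ f w)
    (vr : B v r) (vr' : B v r') (wr' : B w r') (vb : R v b) (vb' : R v b') (wb : R w b)
    (wb' : R w b') (uv : R u v) (uw : B u w) : Splits R B m := by
  by_contra hno
  have rs : ∀ {x y}, R x y → R y x := h.red_symm
  have bs : ∀ {x y}, B x y → B y x := h.blue_symm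
  have us : B u s' := by
    refine h.blue_of_not_red hsr.symm fun e1 => hno ?_
    have hs' := ((PathOn.cons wb (.cons (rs vb) (.cons (rs uv) (.cons e1 hs)))).snoc e)
    rcases ht.start_cases with ⟨rfl, rfl⟩ | ⟨y, t', ht', e', rfl⟩
    · exact .of_singleton_right r' hs' (by grind (ematch := 0))
    · have := h.blue_ne e'
      exact h.splits_of_matched hm (hs'.symm rs) ht' (v := r') (by grind (ematch := 0))
        (by rwa [h1, ← h3]) (by rwa [h4, ne_comm])
  have sb : B s' b := by
    refine h.blue_of_not_red (h3 ▸ hsr) fun e1 => hno ?_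
    rcases ht.start_cases with ⟨rfl, rfl⟩ | ⟨y, t', ht', e2, rfl⟩
    · exact .of_paths ((PathOn.cons uv (.cons vb (.cons (rs e1) hs))).snoc e)
        (.cons wr' (.single r')) (by grind (ematch := 0))
    · have hs' := ((PathOn.cons uv (.cons vb' (.cons (rs wb') (.cons wb (.cons (rs e1) hs))))).snoc e)
      have hy := h.blue_ne e2
      rcases ht'.end_cases bs with ⟨rfl, rfl⟩ | ⟨z, t'', ht'', e3, rfl⟩
      · exact (hy (h3.trans h4.symm)).elim
      · have hz := h.blue_ne e3
        exact h.splits_of_matched hm hs' ht'' (v := r') (by grind (ematch := 0))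
          (by rwa [← h3]) (by rw [h1, ← h4]; exact hz.symm)
  have ht' := PathOn.cons (bs vr) (.cons vr' (.cons (bs wr') (.cons (bs uw) (.cons us (.cons sb ht)))))
  rcases hs.start_cases with ⟨rfl, rfl⟩ | ⟨y, s'', hs'', e2, rfl⟩
  · exact hno (.swap (.of_path ht' (by grind (ematch := 0))))
  · exact hno (.of_paths hs'' ht' (by grind (ematch := 0)))

end TwoColouring

namespace TwoColouring
variable {V : Type*} {f : V → Fin 3} {R B : V → V → Prop} {m : Multiset V}

theorem splits_of_blue_edges_aux (h : TwoColouring f R B) (hm : Fair f m)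
    {u v w r r' s s' b b' t t' : V} {S T : Multiset V} (hs : PathOn R s S s') (e : R r s)
    (e' : R s' r') (ht : PathOn B t T t') (d : B b t) (d' : B t' b')
    (hst : ({r} + S + {r'}) + ({b} + T + {b'}) + {u} + {v} + {w} = m) (h1 : f r = f u)
    (h2 : f r' = f u) (h3 : f b = f u) (h4 : f b' = f u)
    (vr : B v r) (vr' : B v r') (wr' : B w r') (wr : B w r) (vb : R v b) (vb' : R v b') (wb : R w b)
    (wb' : R w b') (uv : B u v) (uw : B u w) (hw : f w ≠ f t') : Splits R B m := by
  by_contra hno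
  have rs : ∀ {x y}, R x y → R y x := h.red_symm
  have bs : ∀ {x y}, B x y → B y x := h.blue_symm
  have hsr := h.red_ne e
  have hsr' := h.red_ne e'
  have key : ∀ {b b' t t' : V}, PathOn B t T t' → B b t → B t' b' →
      ({r} + S + {r'}) + ({b} + T + {b'}) + {u} + {v} + {w} = m → f b = f u → f b' = f u →
      R u t ∧ R r t ∧ R r' t := by
    intro b b' t t' ht d d' hst h3 h4
    have ht' := ht.snoc d'
    have hn : f t ≠ f u := h3 ▸ (h.blue_ne d).symm
    refine ⟨?_, ?_, ?_⟩
    · refine h.red_of_not_blue hn.symm fun e1 => hno ?_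
      exact h.splits_of_matched hm hs (.cons (bs vr) (.cons vr' (.cons (bs wr') (.cons (bs uw)
        (.cons e1 ht'))))) (v := b) (by grind (ematch := 0)) hsr.symm
        (by rwa [h4, ← h2])
    · refine h.red_of_not_blue (h1 ▸ hn.symm) fun e1 => hno ?_
      exact h.splits_of_matched hm hs (.cons uv (.cons vr' (.cons (bs wr') (.cons wr
        (.cons e1 ht'))))) (v := b) (by grind (ematch := 0)) (by rw [← h1]; exact hsr.symm)
        (by rwa [h4, ← h2])
    · refine h.red_of_not_blue (h2 ▸ hn.symm) fun e1 => hno ?_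
      exact h.splits_of_matched hm hs (.cons uv (.cons vr (.cons (bs wr) (.cons wr'
        (.cons e1 ht'))))) (v := b) (by grind (ematch := 0)) (by rw [← h1]; exact hsr.symm)
        (by rwa [h4, ← h2])
  obtain ⟨ut, rt, rt₂⟩ := key ht d d' hst h3 h4
  have hst' : ({r} + S + {r'}) + ({b'} + T + {b}) + {u} + {v} + {w} = m := by
    rw [← hst]; abel
  obtain ⟨ut', rt', rt₂'⟩ := key (ht.symm bs) (bs d') (bs d) hst' h4 h3
  clear key
  have hR : PathOn R r ({r} + S + {r'}) r' := (PathOn.cons e hs).snoc e'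
  have wt' : B w t' := by
    refine h.blue_of_not_red hw fun e1 => hno ?_
    rcases ht.start_cases with ⟨rfl, rfl⟩ | ⟨x, T', hT, e2, rfl⟩
    · exact .of_singleton_right u (((((hR.symm rs).snoc rt).snoc (rs e1)).snoc wb).snoc
        (rs vb) |>.snoc vb') (by grind (ematch := 0))
    · have hs' := ((((((PathOn.cons ut (.cons (rs rt) hR)).snoc rt₂').snoc (rs e1)).snoc wb).snoc
        (rs vb)).snoc vb')
      rcases hT.end_cases bs with ⟨rfl, rfl⟩ | ⟨y, T', hT', e3, rfl⟩
      · exact .of_path hs' (by grind (ematch := 0))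
      · exact .of_paths hs' hT' (by grind (ematch := 0))
  have sb : f s' ≠ f b := by rw [h3, ← h2]; exact hsr'
  have sb' : f s' ≠ f b' := by rw [h4, ← h2]; exact hsr'
  have red_case : ∀ {b b'}, ({r} + S + {r'}) + ({b} + T + {b'}) + {u} + {v} + {w} = m → 
      R v b → R w b → R w b' → R s' b' → False := by
    intro b b' hst vb wb wb' e1
    have hs' := ((PathOn.cons vb (.cons (rs wb) (.cons wb' (.cons (rs e1)
      ((hs.symm rs).snoc (rs e)))))).snoc rt).snoc (rs ut)
    have hvu := h.blue_ne uv
    rcases ht.start_cases with ⟨rfl, rfl⟩ | ⟨x, T', hT, e2, rfl⟩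
    · exact hno (.of_singleton_right r' hs' (by grind (ematch := 0)))
    · have hx : f t' ≠ f u := h4 ▸ h.blue_ne d'
      exact hno (h.splits_of_single hm hs' hT (v := r') (by grind (ematch := 0))
        (by clear * - h2 hvu hx; grind [Blocked]))
  by_cases e1 : R s' b'
  · exact red_case hst vb wb wb' e1
  by_cases e2 : R s' b
  · exact red_case hst' vb' wb' wb e2
  have e1 := h.blue_of_not_red sb' e1
  have e2 := h.blue_of_not_red sb e2
  obtain ⟨T', ⟨z, hT'⟩, hT⟩ : ∃ T', (∃ z, PathOn B u T' z) ∧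
      T' = {u} + {v} + {r'} + {w} + {b'} + {s'} + {b} + T := by
    have h0 : ∀ {Q z}, PathOn B b Q z → PathOn B u
        ({u} + ({v} + ({r'} + ({w} + ({t'} + ({b'} + ({s'} + Q))))))) z := fun hQ =>
      .cons uv (.cons vr' (.cons (bs wr') (.cons wt' (.cons d' (.cons (bs e1) (.cons e2 hQ))))))
    rcases ht.end_cases bs with ⟨rfl, rfl⟩ | ⟨y, T', hT, e3, rfl⟩
    · exact ⟨_, ⟨_, h0 (.single b)⟩, by abel⟩
    · exact ⟨_, ⟨_, h0 (.cons d hT)⟩, by abel⟩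
  rcases hs.end_cases rs with ⟨rfl, rfl⟩ | ⟨y, S', hS, e3, rfl⟩
  · exact hno (.of_paths (.single r) hT' (by grind (ematch := 0)))
  · exact hno (.of_paths (.cons e hS) hT' (by grind (ematch := 0)))

theorem splits_of_blue_edges_singleton (h : TwoColouring f R B)
    {u v w r b b' t t' : V} {T : Multiset V} (ht : PathOn B t T t') (d : B b t) (d' : B t' b')
    (hst : {r} + ({b} + T + {b'}) + {u} + {v} + {w} = m) (h1 : f r = f u)
    (h3 : f b = f u) (h4 : f b' = f u) (vr : B v r) (wr : B w r) (vb : R v b) (vb' : R v b')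
    (wb : R w b) (uv : B u v) (uw : B u w) (hw : f w ≠ f t') : Splits R B m := by
  by_contra hno
  have rs : ∀ {x y}, R x y → R y x := h.red_symm
  have bs : ∀ {x y}, B x y → B y x := h.blue_symm
  have key : ∀ {b b' t t' : V}, PathOn B t T t' → B b t → B t' b' →
      {r} + ({b} + T + {b'}) + {u} + {v} + {w} = m → f b = f u → R u t ∧ R r t := by
    intro b b' t t' ht d d' hst h3
    have ht' := ht.snoc d'
    have hn : f t ≠ f u := h3 ▸ (h.blue_ne d).symm
    constructor
    · refine h.red_of_not_blue hn.symm fun e1 => hno ?_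
      exact .of_paths (.single b) (.cons vr (.cons (bs wr) (.cons (bs uw) (.cons e1 ht'))))
        (by grind (ematch := 0))
    · refine h.red_of_not_blue (h1 ▸ hn.symm) fun e1 => hno ?_
      exact .of_paths (.single b) (.cons (bs uv) (.cons uw (.cons wr (.cons e1 ht'))))
        (by grind (ematch := 0))
  have hst' : {r} + ({b'} + T + {b}) + {u} + {v} + {w} = m := by rw [← hst]; abel
  obtain ⟨ut, rt⟩ := key ht d d' hst h3
  obtain ⟨ut', -⟩ := key (ht.symm bs) (bs d') (bs d) hst' h4
  rcases h.total hw with e1 | e1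
  · have hs : ∀ {b b'}, R v b → R v b' → R w b → PathOn R t' ({t'} + ({w} + ({b} + ({v} + {b'})))) b' :=
      fun vb vb' wb => .cons (rs e1) (.cons wb (.cons (rs vb) (.cons vb' (.single _))))
    have hs' := hs vb vb' wb
    rcases ht.start_cases with ⟨rfl, rfl⟩ | ⟨x, T', hT, e2, rfl⟩
    · exact hno (.of_singleton_right r (.cons ut' hs') (by grind (ematch := 0)))
    · have hs'' := PathOn.cons rt (.cons (rs ut) (.cons ut' hs'))
      rcases hT.end_cases bs with ⟨rfl, rfl⟩ | ⟨y, T', hT', e3, rfl⟩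
      · exact hno (.of_path hs'' (by grind (ematch := 0)))
      · exact hno (.of_paths hs'' hT' (by grind (ematch := 0)))
  · exact hno (.of_paths (.single b') ((((PathOn.cons d ht).snoc (bs e1)).snoc wr).snoc (bs vr) |>.snoc
      (bs uv)) (by grind (ematch := 0)))

theorem splits_of_blue_edges (h : TwoColouring f R B) (hm : Fair f m)
    {u v w r r' b b' : V} {S T : Multiset V} (hs : PathOn R r S r') (ht : PathOn B b T b')
    (hst : S + T + {u} + {v} + {w} = m) (h1 : f r = f u)
    (h2 : f r' = f u) (h3 : f b = f u) (h4 : f b' = f u) (hvw : f v ≠ f w)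
    (vr : B v r) (vr' : B v r') (wr' : B w r') (wr : B w r) (vb : R v b) (vb' : R v b') (wb : R w b)
    (wb' : R w b') (uv : B u v) (uw : B u w) : Splits R B m := by
  have rs : ∀ {x y}, R x y → R y x := h.red_symm
  have bs : ∀ {x y}, B x y → B y x := h.blue_symm
  have hst' : S + T + {u} + {w} + {v} = m := by rw [← hst]; abel
  rcases hs.start_cases with ⟨rfl, rfl⟩ | ⟨s, S₁, hs₁, e, rfl⟩
  · rcases ht.start_cases with ⟨rfl, rfl⟩ | ⟨t, T₁, ht₁, d, rfl⟩
    · have := hm.fair (f u)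
      have hv := h.blue_ne uv
      have hw := h.blue_ne uw
      simp [← hst, ← Multiset.cons_zero, h1, h3, hv.symm, hw.symm] at this
    rcases ht₁.end_cases bs with ⟨rfl, rfl⟩ | ⟨t', T, ht₂, d', rfl⟩
    · exact (h.blue_ne d (h3.trans h4.symm)).elim
    by_cases hw : f w = f t'
    · exact h.splits_of_blue_edges_singleton ht₂ d d' (by rw [← hst']; abel) h1 h3 h4 wr vr wb wb'
        vb uw uv (hw ▸ hvw)
    · exact h.splits_of_blue_edges_singleton ht₂ d d' (by rw [← hst]; abel) h1 h3 h4 vr wr vb vb'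
        wb uv uw hw
  rcases hs₁.end_cases rs with ⟨rfl, rfl⟩ | ⟨s', S, hs₂, e', rfl⟩
  · exact (h.red_ne e (h1.trans h2.symm)).elim
  rcases ht.start_cases with ⟨rfl, rfl⟩ | ⟨t, T₁, ht₁, d, rfl⟩
  · have hsr := h.red_ne e
    have hsr' := h.red_ne e'
    exact h.splits_of_matched hm hs₂ (.cons (bs vr) (.cons vr' (.cons (bs wr') (.cons (bs uw)
      (.single u))))) (v := b) (by grind (ematch := 0)) hsr.symm (by rwa [← h2])
  rcases ht₁.end_cases bs with ⟨rfl, rfl⟩ | ⟨t', T, ht₂, d', rfl⟩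
  · exact (h.blue_ne d (h3.trans h4.symm)).elim
  by_cases hw : f w = f t'
  · exact h.splits_of_blue_edges_aux hm hs₂ e e' ht₂ d d' (by rw [← hst']; abel) h1 h2 h3 h4 wr wr'
      vr' vr wb wb' vb vb' uw uv (hw ▸ hvw)
  · exact h.splits_of_blue_edges_aux hm hs₂ e e' ht₂ d d' (by rw [← hst]; abel) h1 h2 h3 h4 vr vr'
      wr' wr vb vb' wb wb' uv uw hw

theorem splits_of_four_ends (h : TwoColouring f R B) (hm : Fair f m)
    {u v w r r' b b' : V} {s t : Multiset V} (hs : PathOn R r s r') (ht : PathOn B b t b')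
    (hst : s + t + {u} + {v} + {w} = m) (h1 : f r = f u) (h2 : f r' = f u) (h3 : f b = f u)
    (h4 : f b' = f u) (huv : f u ≠ f v) (huw : f u ≠ f w) (hvw : f v ≠ f w) :
    Splits R B m := by
  by_contra hno
  have rs : ∀ {x y}, R x y → R y x := h.red_symm
  have bs : ∀ {x y}, B x y → B y x := h.blue_symm
  have hs' := hs.symm rs
  have ht' := ht.symm bs
  have hst' : s + t + {u} + {w} + {v} = m := by rw [← hst]; abel
  have noR : ∀ {v w r r'}, PathOn R r s r' → s + t + {u} + {v} + {w} = m → f u ≠ f v →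
      f u ≠ f w → f r = f u → f r' = f u → B v r := fun hs hst huv huw h1 h2 =>
    h.blue_of_not_red (h1 ▸ huv.symm) fun e => hno
      (h.splits_of_four_ends_attach hm hs ht hst h1 h2 h3 h4 huv huw e)
  have noB : ∀ {v w b b'}, PathOn B b t b' → s + t + {u} + {v} + {w} = m → f u ≠ f v →
      f u ≠ f w → f b = f u → f b' = f u → R v b := fun ht hst huv huw h3 h4 =>
    h.red_of_not_blue (h3 ▸ huv.symm) fun e => hno (.swap (h.swap.splits_of_four_ends_attach hm ht hs
      (by rw [← hst, add_comm t]) h3 h4 h1 h2 huv huw e))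
  have vr := noR hs hst huv huw h1 h2
  have vr' := noR hs' hst huv huw h2 h1
  have wr := noR hs hst' huw huv h1 h2
  have wr' := noR hs' hst' huw huv h2 h1
  have vb := noB ht hst huv huw h3 h4
  have vb' := noB ht' hst huv huw h4 h3
  have wb := noB ht hst' huw huv h3 h4
  have wb' := noB ht' hst' huw huv h4 h3
  have mixed : ∀ {v w}, s + t + {u} + {v} + {w} = m → f u ≠ f v → f u ≠ f w → B v r → B v r' → B w r → B w r' →
      R v b → R v b' → R w b → R w b' → R u v → B u w → False := by
    intro v w hst huv huw vr vr' wr wr' vb vb' wb wb' uv uw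
    rcases hs.start_cases with ⟨rfl, rfl⟩ | ⟨y, s₁, hs₁, e, rfl⟩
    · rcases ht.start_cases with ⟨rfl, rfl⟩ | ⟨y, t₁, ht₁, e, rfl⟩
      · have := hm.fair (f u)
        simp [← hst, ← Multiset.cons_zero, h1, h3, huv.symm, huw.symm] at this
      rcases ht₁.end_cases bs with ⟨rfl, rfl⟩ | ⟨z, t₂, ht₂, e', rfl⟩
      · exact h.blue_ne e (h3.trans h4.symm)
      exact hno (.swap (h.swap.splits_of_mixed_edges hm (ht₂.symm bs) (bs e)
        (h4 ▸ h.blue_ne e') hs (r' := b') (by rw [← hst]; abel) h3 h1 h2 huv wb wb' vb' wr wr' vr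
        vr' uw uv))
    rcases hs₁.end_cases rs with ⟨rfl, rfl⟩ | ⟨z, s₂, hs₂, e', rfl⟩
    · exact h.red_ne e (h1.trans h2.symm)
    exact hno (h.splits_of_mixed_edges hm (hs₂.symm rs) (rs e)
      (h2 ▸ h.red_ne e') ht (r' := r') (by rw [← hst]; abel) h1 h3 h4 huw vr vr' wr' vb vb' wb
      wb' uv uw)
  rcases h.total huv with uv | uv <;> rcases h.total huw with uw | uw
  · exact hno (.swap (h.swap.splits_of_blue_edges hm ht hs (by rw [← hst, add_comm t]) h3 h4 h1 h2
      hvw vb vb' wb' wb vr vr' wr wr' uv uw))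
  · exact mixed hst huv huw vr vr' wr wr' vb vb' wb wb' uv uw
  · exact mixed hst' huw huv wr wr' vr vr' wb wb' vb vb' uw uv
  · exact hno (h.splits_of_blue_edges hm hs ht hst h1 h2 h3 h4
      hvw vr vr' wr' wr vb vb' wb wb' uv uw)

theorem splits_of_triple_same_ends (h : TwoColouring f R B) (hm : Fair f m)
    {u v w r r' b b' : V} {s t : Multiset V} (hs : PathOn R r s r') (ht : PathOn B b t b')
    (hst : s + t + {u} + {v} + {w} = m) (huv : f u ≠ f v) (huw : f u ≠ f w) (hvw : f v ≠ f w)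
    (h2 : f r' = f r) (h3 : f b = f r) : Splits R B m := by
  have key : ∀ {u v w}, s + t + {u} + {v} + {w} = m → f u ≠ f v → f u ≠ f w → f v ≠ f w →
      f r = f u → Splits R B m := by
    intro u v w hst huv huw hvw h1
    have hst' : s + t + {u} + {w} + {v} = m := by rw [← hst]; abel
    rw [h1] at h2 h3
    by_cases h4 : f b' = f u
    · exact h.splits_of_four_ends hm hs ht hst h1 h2 h3 h4 huv huw hvw
    by_cases h5 : f b' = f v
    · exact h.splits_of_triple_three_ends hm hs ht hst h1 h2 h3 h5 huv huw hvw
    · exact h.splits_of_triple_three_ends hm hs ht hst' h1 h2 h3 (by omega) huw huv hvw.symm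
  by_cases h1 : f r = f u
  · exact key hst huv huw hvw h1
  by_cases h1 : f r = f v
  · exact key (by rw [← hst]; abel) huv.symm hvw huw h1
  · exact key (u := w) (v := u) (w := v) (by rw [← hst]; abel) huw.symm hvw.symm huv (by omega)

theorem splits_of_triple (h : TwoColouring f R B) (hm : Fair f m)
    {u v w r r' b b' : V} {s t : Multiset V} (hs : PathOn R r s r') (ht : PathOn B b t b')
    (hst : s + t + {u} + {v} + {w} = m) (huv : f u ≠ f v) (huw : f u ≠ f w) (hvw : f v ≠ f w) :
    Splits R B m := by
  have hs' := hs.symm h.red_symm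
  have ht' := ht.symm h.blue_symm
  have hst' : t + s + {u} + {v} + {w} = m := by rw [← hst, add_comm t]
  have matched : ∀ {r r' b b'}, PathOn R r s r' → PathOn B b t b' → f r ≠ f b → f r' ≠ f b' →
      Splits R B m := by
    intro r r' b b' hs ht h1 h2
    have key : ∀ {u v w}, s + t + {u} + {v} + {w} = m → f u ≠ f v → f u ≠ f w → f v ≠ f w →
        f r = f u → Splits R B m := by
      intro u v w hst huv huw hvw hu
      by_cases hv : f b = f v
      · exact h.splits_of_triple_matched hm hs ht hst hu.symm hv.symm huw.symm hvw.symm h1 h2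
      · exact h.splits_of_triple_matched hm hs ht (u := u) (v := w) (x := v) (by rw [← hst]; abel)
          hu.symm (by omega) huv.symm hvw h1 h2
    by_cases h1 : f r = f u
    · exact key hst huv huw hvw h1
    by_cases h1 : f r = f v
    · exact key (by rw [← hst]; abel) huv.symm hvw huw h1
    · exact key (u := w) (v := u) (w := v) (by rw [← hst]; abel) huw.symm hvw.symm huv (by omega)
  by_cases m1 : f r ≠ f b ∧ f r' ≠ f b'
  · exact matched hs ht m1.1 m1.2
  by_cases m2 : f r ≠ f b' ∧ f r' ≠ f b
  · exact matched hs ht' m2.1 m2.2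
  by_cases e1 : f r' = f r ∧ f b = f r
  · exact h.splits_of_triple_same_ends hm hs ht hst huv huw hvw e1.1 e1.2
  by_cases e2 : f r' = f r ∧ f b' = f r
  · exact h.splits_of_triple_same_ends hm hs ht' hst huv huw hvw e2.1 e2.2
  by_cases e3 : f b' = f b ∧ f r = f b
  · exact (h.swap.splits_of_triple_same_ends hm ht hs hst' huv huw hvw e3.1 e3.2).swap
  · exact (h.swap.splits_of_triple_same_ends hm ht hs' hst' huv huw hvw (by omega) (by omega)).swap

end TwoColouring

namespace PathOn
variable {V : Type*} {R R' : V → V → Prop}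

theorem mono (hR : ∀ {x y}, R x y → R' x y) {a b : V} {s : Multiset V} (h : PathOn R a s b) :
    PathOn R' a s b := by
  induction h with
  | single a => exact .single a
  | cons e _ ih => exact .cons (hR e) ih

/-- The number of vertices of an alternating path on one side of a bipartition. -/
theorem two_mul_countP {g : V → Bool} (hR : ∀ {x y}, R x y → g x ≠ g y) {a b : V}
    {s : Multiset V} (h : PathOn R a s b) (β : Bool) :
    2 * s.countP (g · = β) + 1 =
      s.card + (if g a = β then 1 else 0) + (if g b = β then 1 else 0) := by
  induction h with
  | single a => by_cases h : g a = β <;> simp [h, ← Multiset.cons_zero]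
  | @cons a b d s e _ ih =>
    have : g a = β ↔ g b ≠ β := by
      have := hR e
      revert this
      cases g a <;> cases g b <;> cases β <;> simp
    simp only [Multiset.singleton_add, Multiset.card_cons, Multiset.countP_cons]
    by_cases h : g b = β <;> simp [this, h] at ih ⊢ <;> omega

/-- A complete balanced bipartite graph has a Hamiltonian path. -/
theorem of_complete (hR : ∀ {x y}, R x y → R y x) {x y : V} {X Y : Multiset V}
    (hXY : ∀ x ∈ X, ∀ y ∈ Y, R x y) (hc : X.card = Y.card) (hx : x ∈ X) (hy : y ∈ Y) :
    PathOn R x (X + Y) y := by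
  induction hn : X.card generalizing x X Y with
  | zero => simp [Multiset.card_eq_zero.1 hn] at hx
  | succ n ih =>
    obtain ⟨X, rfl⟩ := Multiset.exists_cons_of_mem hx
    obtain ⟨Y, rfl⟩ := Multiset.exists_cons_of_mem hy
    rcases X.empty_or_exists_mem with rfl | ⟨x', hx'⟩
    · obtain rfl : Y = 0 := by simpa using hc.symm
      exact (PathOn.cons (hXY x (by simp) y (by simp)) (.single y)).congr (by simp)
    · obtain ⟨y', hy'⟩ : ∃ y', y' ∈ Y := by
        by_contra! hY
        rw [Multiset.eq_zero_of_forall_notMem hY] at hc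
        simp at hc
        simp [hc] at hx'
      obtain ⟨Y, rfl⟩ := Multiset.exists_cons_of_mem hy'
      have := ih (x := x') (X := X) (Y := y ::ₘ Y)
        (fun x hx y hy => hXY x (by simp [hx]) y (by simp at hy ⊢; tauto))
        (by simpa using hc) hx' (by simp) (by simpa using hn)
      refine (PathOn.cons (hXY x (by simp) y' (by simp))
        (.cons (hR (hXY x' (by simp [hx']) y' (by simp))) this)).congr ?_
      simp only [Multiset.singleton_add, Multiset.cons_add, Multiset.add_cons]

end PathOn

/-- The multisets `A₁`, `A₂`, `W₁`, `W₂` form a split colouring: blue edges between the parts with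
the same index, red edges between the parts with distinct indices. -/
structure SplitParts {V : Type*} (g : V → Bool) (R B : V → V → Prop) (A₁ A₂ W₁ W₂ : Multiset V) :
    Prop where
  ne₁ : A₁ ≠ 0
  ne₂ : A₂ ≠ 0
  ne₃ : W₁ ≠ 0
  ne₄ : W₂ ≠ 0
  side : ∀ x ∈ A₁ + A₂, ∀ y ∈ W₁ + W₂, g x ≠ g y
  blue₁ : ∀ x ∈ A₁, ∀ y ∈ W₁, B x y
  blue₂ : ∀ x ∈ A₂, ∀ y ∈ W₂, B x y
  red₁ : ∀ x ∈ A₁, ∀ y ∈ W₂, R x y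
  red₂ : ∀ x ∈ A₂, ∀ y ∈ W₁, R x y

/-- The multiset `m` carries a split colouring. -/
def HasSplit {V : Type*} (g : V → Bool) (R B : V → V → Prop) (m : Multiset V) : Prop :=
  ∃ A₁ A₂ W₁ W₂, SplitParts g R B A₁ A₂ W₁ W₂ ∧ A₁ + A₂ + W₁ + W₂ = m

namespace SplitParts
variable {V : Type*} {g : V → Bool} {R B : V → V → Prop} {A₁ A₂ W₁ W₂ : Multiset V}

theorem swap (h : SplitParts g R B A₁ A₂ W₁ W₂) : SplitParts g B R A₁ A₂ W₂ W₁ :=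
  ⟨h.ne₁, h.ne₂, h.ne₄, h.ne₃, fun x hx y hy => h.side x hx y (by rwa [add_comm]), h.red₁, h.red₂,
    h.blue₁, h.blue₂⟩

theorem rotate (h : SplitParts g R B A₁ A₂ W₁ W₂) : SplitParts g R B A₂ A₁ W₂ W₁ :=
  ⟨h.ne₂, h.ne₁, h.ne₄, h.ne₃, fun x hx y hy => h.side x (by rwa [add_comm]) y (by rwa [add_comm]),
    h.blue₂, h.blue₁, h.red₂, h.red₁⟩

theorem transpose (h : SplitParts g R B A₁ A₂ W₁ W₂) (hR : ∀ {x y}, R x y → R y x)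
    (hB : ∀ {x y}, B x y → B y x) : SplitParts g R B W₁ W₂ A₁ A₂ :=
  ⟨h.ne₃, h.ne₄, h.ne₁, h.ne₂, fun x hx y hy => (h.side y hy x hx).symm,
    fun x hx y hy => hB (h.blue₁ y hy x hx), fun x hx y hy => hB (h.blue₂ y hy x hx),
    fun x hx y hy => hR (h.red₂ y hy x hx), fun x hx y hy => hR (h.red₁ y hy x hx)⟩

end SplitParts

theorem HasSplit.swap {V : Type*} {g : V → Bool} {R B : V → V → Prop} {m : Multiset V}
    (h : HasSplit g R B m) : HasSplit g B R m := by
  obtain ⟨A₁, A₂, W₁, W₂, h, rfl⟩ := h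
  exact ⟨A₁, A₂, W₂, W₁, h.swap, by abel⟩

theorem Bool.eq_of_ne_of_ne' {a b c : Bool} (h : a ≠ b) (h' : c ≠ b) : a = c := by
  revert h h'; cases a <;> cases b <;> cases c <;> simp

/-- If all chords of length three of a cycle are in `R`, then an arc of the cycle can be appended
to a path which ends just outside the arc. -/
theorem PathOn.exists_hop {V : Type*} {g : V → Bool} {R : V → V → Prop} {Z : Multiset V} {β : Bool}
    (hR : ∀ {x y}, R x y → R y x) (hg : ∀ {x y}, R x y → g x ≠ g y)
    (hZ : ∀ {e x a b L}, PathOn R b L e → R e x → R x a → R a b → L + {x} + {a} = Z → g e = β →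
      R e b) {q q' c : V} (hcq : R c q) (hc : g c ≠ β) (N : ℕ) :
    ∀ {e x a : V} {D T M : Multiset V}, PathOn R q D e → R e x → R x a → PathOn R a M c →
      D + {x} + M = Z → g e = β → PathOn R q' T e → M.card = N →
      ∃ T' z, PathOn R q' T' z ∧ T' = T + M := by
  induction N using Nat.strong_induction_on with
  | _ N ih =>
  intro e x a D T M hD hex hxa hM hDM he hT hN
  have hga : g a = β := by
    rw [← he]; exact Bool.eq_of_ne_of_ne' (hg hxa).symm (hg hex)
  rcases hM.start_cases with ⟨rfl, rfl⟩ | ⟨b, M₁, hM₁, hab, rfl⟩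
  · exact (hc hga).elim
  have heb : R e b := hZ (hM₁.append hcq hD) hex hxa hab (by grind (ematch := 0)) he
  have hT' := (hT.snoc heb).snoc (hR hab)
  rcases hM₁.start_cases with ⟨rfl, rfl⟩ | ⟨a', M₂, hM₂, hba', rfl⟩
  · exact ⟨_, _, hT', by abel⟩
  · obtain ⟨T', z, h1, rfl⟩ := ih M₂.card (by simp at hN; omega) ((hD.snoc hex).snoc hxa) hab hba'
      hM₂ (by grind (ematch := 0)) hga hT' rfl
    exact ⟨_, _, h1, by abel⟩

namespace TwoColouring
variable {V : Type*} {g : V → Bool} {R B : V → V → Prop} {m : Multiset V}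

section
variable {u a d i i' : V} {Z I : Multiset V}

theorem blue_of_cycle (h : TwoColouring g R B) (hno : ¬ Splits R B m) (hZ : PathOn R a Z d)
    (hda : R d a) (hI : PathOn B i I i') (hm : Z + I + {u} = m) (hu : g u ≠ g i) {z : V}
    (hz : z ∈ Z) (hzi : g z = g i) : B u z := by
  refine h.blue_of_not_red (hzi ▸ hu) fun e => hno ?_
  obtain ⟨y, hy, -⟩ := hZ.rotate h.red_symm hda hz
  exact .of_paths (.cons e hy) hI (by grind (ematch := 0))

theorem red_of_cycle (h : TwoColouring g R B) (hno : ¬ Splits R B m) (hZ : PathOn R a Z d)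
    (hI : PathOn B i I i') (hm : Z + I + {u} = m) (hu : g u ≠ g i) : R u i := by
  refine h.red_of_not_blue hu fun e => hno ?_
  exact .of_paths hZ (.cons e hI) (by grind (ematch := 0))

theorem end_blue_of_cycle (h : TwoColouring g R B) (hno : ¬ Splits R B m) (hZ : PathOn R a Z d)
    (hda : R d a) (hI : PathOn B i I i') (hm : Z + I + {u} = m) (hu : g u ≠ g i) {z : V}
    (hz : z ∈ Z) (hzi : g z ≠ g i) : B i z := by
  refine h.blue_of_not_red hzi.symm fun e => hno ?_
  have hui := h.red_of_cycle hno hZ hI hm hu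
  obtain ⟨y, hy, -⟩ := hZ.rotate h.red_symm hda hz
  rcases hI.start_cases with ⟨rfl, rfl⟩ | ⟨j, I', hI', e', rfl⟩
  · exact .of_path (.cons hui (.cons e hy)) (by grind (ematch := 0))
  · exact .of_paths (.cons hui (.cons e hy)) hI' (by grind (ematch := 0))

theorem red_on_cycle (h : TwoColouring g R B) (hno : ¬ Splits R B m) (hZ : PathOn R a Z d)
    (hda : R d a) (hI : PathOn B i I i') (hii : g i' = g i) (hm : Z + I + {u} = m)
    (hu : g u ≠ g i) {p q : V}
    (hp : p ∈ Z) (hpi : g p ≠ g i) (hq : q ∈ Z) (hqi : g q = g i) : R p q := by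
  by_contra hpq
  have rs : ∀ {x y}, R x y → R y x := h.red_symm
  have bs : ∀ {x y}, B x y → B y x := h.blue_symm
  have hpq' := h.blue_of_not_red (by rwa [hqi]) hpq
  have hI' := hI.symm bs
  have three : ∀ {e x a b L}, PathOn R b L e → R e x → R x a → R a b → L + {x} + {a} = Z →
      g e = g i → R e b := by
    intro e x a b L hL ex xa ab hLZ he
    have hx : g x ≠ g i := he ▸ (h.red_ne ex).symm
    have ha : g a = g i := by
      rw [← he]; exact Bool.eq_of_ne_of_ne' (h.red_ne xa).symm (h.red_ne ex)
    have hb : g b ≠ g i := ha ▸ (h.red_ne ab).symm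
    refine h.red_of_not_blue (he ▸ hb.symm) fun eb => hno ?_
    have hB := PathOn.cons (bs (h.blue_of_cycle hno hZ hda hI hm hu (z := a) (by simp [← hLZ]) ha))
      (.cons (h.blue_of_cycle hno hZ hda hI hm hu (z := e) (by simp [← hLZ, hL.end_mem]) he)
      (.cons eb (.cons (bs (h.end_blue_of_cycle hno hZ hda hI hm hu (z := b)
        (by simp [← hLZ, hL.start_mem]) hb)) (hI.snoc (h.end_blue_of_cycle hno hZ hda hI'
        hm (hii ▸ hu) (z := x) (by simp [← hLZ]) (hii ▸ hx))))))
    rcases hL.start_cases with ⟨rfl, rfl⟩ | ⟨y, L', hL', -, rfl⟩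
    · exact (hb he).elim
    rcases hL'.end_cases rs with ⟨rfl, rfl⟩ | ⟨z, L'', hL'', -, rfl⟩
    · exact .swap (.of_path hB (by grind (ematch := 0)))
    · exact .of_paths hL'' hB (by grind (ematch := 0))
  have huq := h.blue_of_cycle hno hZ hda hI hm hu hq hqi
  have hip := h.end_blue_of_cycle hno hZ hda hI hm hu hp hpi
  have hB := PathOn.cons huq (.cons (bs hpq') (.cons (bs hip) hI))
  obtain ⟨y, hy, hyp⟩ := hZ.rotate rs hda hp
  obtain ⟨U, hU, ⟨rfl, -⟩ | ⟨q', w, hqq', hw, rfl⟩⟩ := hy.split hq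
  · exact hpq (rs hyp)
  rcases hU.start_cases with ⟨rfl, rfl⟩ | ⟨a', U₁, hU₁, hpa, rfl⟩
  · exact hpi hqi
  rcases hU₁.end_cases rs with ⟨rfl, rfl⟩ | ⟨c, M, hM, hcq, rfl⟩
  · exact hpq hpa
  obtain ⟨T', z, h1, rfl⟩ := PathOn.exists_hop (R := R) (β := g i) (c := c) rs h.red_ne three hcq
    (hqi ▸ h.red_ne hcq) _ (.cons hqq' hw) hyp hpa hM (by grind (ematch := 0))
    (Bool.eq_of_ne_of_ne' (h.red_ne hyp) hpi.symm) hw rfl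
  exact hno (.of_paths h1 hB (by grind (ematch := 0)))

theorem hasSplit_of_cycle (h : TwoColouring g R B) (hno : ¬ Splits R B m) (hZ : PathOn R a Z d)
    (hda : R d a) (hI : PathOn B i I i') (hii : g i' = g i) (hm : Z + I + {u} = m)
    (hu : g u ≠ g i) : HasSplit g R B m := by
  have rs : ∀ {x y}, R x y → R y x := h.red_symm
  have bs : ∀ {x y}, B x y → B y x := h.blue_symm
  have hI' := hI.symm bs
  have hno' : ¬ Splits B R m := mt Splits.swap hno
  have hR : ∀ x ∈ Z, g x ≠ g i → ∀ y ∈ Z, g y = g i → R x y := fun x hx hxi y hy hyi =>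
    h.red_on_cycle hno hZ hda hI hii hm hu hx hxi hy hyi
  -- the colour-swapped configuration obtained by moving a vertex `z` to the other cycle
  have key : ∀ c z p' P, PathOn R c P p' → R p' z → R c z → Z = {z} + P → g z ≠ g i →
      (∀ y ∈ I, g y = g i → R u y) ∧ (∀ y ∈ I, g y ≠ g i → R y c) ∧
      (∀ x ∈ {z} + I, g x ≠ g i → ∀ y ∈ I, g y = g i → B x y) := by
    intro c z p' P hP hpz hcz hZP hzi
    have hci : g c = g i := Bool.eq_of_ne_of_ne' (h.red_ne hcz) hzi.symm
    have hp' : g p' = g c := Bool.eq_of_ne_of_ne' (h.red_ne hpz) (h.red_ne hcz)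
    have hz : z ∈ Z := by simp [hZP]
    have e := h.end_blue_of_cycle hno hZ hda hI' hm (hii ▸ hu) hz (hii ▸ hzi)
    have hB := PathOn.cons (bs (h.end_blue_of_cycle hno hZ hda hI hm hu hz hzi)) hI
    have hm' : {z} + I + P + {u} = m := by grind (ematch := 0)
    refine ⟨fun y hy hyi => ?_, fun y hy hyi => ?_, fun x hx hxi y hy hyi => ?_⟩
    · exact h.swap.blue_of_cycle hno' hB e hP hm' (hci ▸ hu) (by simp [hy]) (hci ▸ hyi)
    · exact rs (h.swap.end_blue_of_cycle hno' hB e hP hm' (hci ▸ hu) (by simp [hy]) (hci ▸ hyi))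
    · exact h.swap.red_on_cycle hno' hB e hP hp' hm' (hci ▸ hu) hx (hci ▸ hxi) (by simp [hy])
        (hci ▸ hyi)
  have hW : ∀ c ∈ Z, g c = g i →
      ∃ z p' P, PathOn R c P p' ∧ R p' z ∧ R c z ∧ Z = {z} + P ∧ g z ≠ g i := by
    intro c hc hci
    obtain ⟨z, h1, e⟩ := hZ.rotate rs hda hc
    rcases h1.end_cases rs with ⟨-, rfl⟩ | ⟨p', P, hP, e', h2⟩
    · exact (h.red_ne e rfl).elim
    · exact ⟨z, p', P, hP, e', rs e, h2, hci ▸ h.red_ne e⟩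
  have hU : ∀ z ∈ Z, g z ≠ g i →
      ∃ c p' P, PathOn R c P p' ∧ R p' z ∧ R c z ∧ Z = {z} + P := by
    intro z hz hzi
    obtain ⟨c, h1, e⟩ := hZ.rotate rs hda hz
    rcases h1.start_cases with ⟨-, rfl⟩ | ⟨p', P, hP, e', h2⟩
    · exact (h.red_ne e rfl).elim
    · exact ⟨c, p', P, hP.symm rs, rs e', e, h2⟩
  obtain ⟨c, hc, hci, z, hz, hzi⟩ : ∃ c ∈ Z, g c = g i ∧ ∃ z ∈ Z, g z ≠ g i := by
    have := h.red_ne hda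
    by_cases hai : g a = g i
    · exact ⟨a, hZ.start_mem, hai, d, hZ.end_mem, hai ▸ this⟩
    · exact ⟨d, hZ.end_mem, Bool.eq_of_ne_of_ne' this (Ne.symm hai), a, hZ.start_mem, hai⟩
  obtain ⟨_, _, _, k1, k2, k3, k4, k5⟩ := hW c hc hci
  obtain ⟨k1, -, k3⟩ := key _ _ _ _ k1 k2 k3 k4 k5
  refine ⟨{u}, (I + Z).filter (g · ≠ g i), Z.filter (g · = g i), I.filter (g · = g i),
    ⟨by simp, ?_, ?_, ?_, ?_, ?_, ?_, ?_, ?_⟩, ?_⟩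
  · exact fun e => Multiset.notMem_zero z (e ▸ Multiset.mem_filter.2 ⟨by simp [hz], hzi⟩)
  · exact fun e => Multiset.notMem_zero c (e ▸ Multiset.mem_filter.2 ⟨hc, hci⟩)
  · exact fun e => Multiset.notMem_zero i (e ▸ Multiset.mem_filter.2 ⟨hI.start_mem, rfl⟩)
  · intro x hx y hy
    have hx : g x ≠ g i := by
      simp at hx; rcases hx with rfl | hx
      · exact hu
      · tauto
    have hy : g y = g i := by simp at hy; tauto
    exact hy ▸ hx
  · intro x hx y hy
    simp at hx hy
    exact hx ▸ h.blue_of_cycle hno hZ hda hI hm hu hy.1 hy.2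
  · intro x hx y hy
    simp at hx hy
    obtain ⟨hx, hxi⟩ | ⟨hx, hxi⟩ := hx
    · exact k3 x (by simp [hx]) hxi y hy.1 hy.2
    · obtain ⟨_, _, _, k1, k2, k3, k4⟩ := hU x hx hxi
      exact (key _ _ _ _ k1 k2 k3 k4 hxi).2.2 x (by simp) hxi y hy.1 hy.2
  · intro x hx y hy
    simp at hx hy
    exact hx ▸ k1 y hy.1 hy.2
  · intro x hx y hy
    simp at hx hy
    obtain ⟨hx, hxi⟩ | ⟨hx, hxi⟩ := hx
    · obtain ⟨_, _, _, k1, k2, k3, k4, k5⟩ := hW y hy.1 hy.2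
      exact (key _ _ _ _ k1 k2 k3 k4 k5).2.1 x hx hxi
    · exact hR x hx hxi y hy.1 hy.2
  · have h1 := Multiset.filter_add_not (g · = g i) I
    have h2 := Multiset.filter_add_not (g · = g i) Z
    rw [Multiset.filter_add, ← hm]
    conv_rhs => rw [← h1, ← h2]
    abel
end

end TwoColouring

/-- `OpenPath R x P y`: the multiset `P` is the interior of a path from `x` to `y`. -/
def OpenPath {V : Type*} (R : V → V → Prop) (x : V) (P : Multiset V) (y : V) : Prop :=
  (P = 0 ∧ R x y) ∨ ∃ p p', PathOn R p P p' ∧ R x p ∧ R p' y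

namespace OpenPath
variable {V : Type*} {R : V → V → Prop} {x y : V} {P : Multiset V}

theorem symm (hR : ∀ {x y}, R x y → R y x) (h : OpenPath R x P y) : OpenPath R y P x := by
  obtain ⟨h, e⟩ | ⟨p, p', h, e, e'⟩ := h
  · exact .inl ⟨h, hR e⟩
  · exact .inr ⟨p', p, h.symm hR, hR e', hR e⟩

theorem full (h : OpenPath R x P y) : PathOn R x ({x} + P + {y}) y := by
  obtain ⟨rfl, e⟩ | ⟨p, p', h, e, e'⟩ := h
  · exact (PathOn.single x).snoc e
  · exact (PathOn.cons e h).snoc e'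

theorem half (h : OpenPath R x P y) : ∃ z, PathOn R x ({x} + P) z := by
  obtain ⟨rfl, e⟩ | ⟨p, p', h, e, e'⟩ := h
  · exact ⟨x, .single x⟩
  · exact ⟨p', .cons e h⟩

theorem inner (h : OpenPath R x P y) : P = 0 ∨ ∃ a b, PathOn R a P b := by
  obtain ⟨rfl, e⟩ | ⟨p, p', h, e, e'⟩ := h
  · exact .inl rfl
  · exact .inr ⟨p, p', h⟩

end OpenPath

namespace TwoColouring
variable {V : Type*} {g : V → Bool} {R B : V → V → Prop} {m : Multiset V}

section
variable {u w x y : V} {P Q : Multiset V}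

theorem splits_of_open_ne (h : TwoColouring g R B) (hP : OpenPath R x P y) (hQ : OpenPath B x Q y)
    (hm : {x} + {y} + P + Q + {u} + {w} = m) (hxy : g x ≠ g y) (huw : g u ≠ g w)
    (hux : g u = g x) : Splits R B m := by
  have rs : ∀ {x y}, R x y → R y x := h.red_symm
  have bs : ∀ {x y}, B x y → B y x := h.blue_symm
  obtain ⟨p, hp⟩ := hP.half
  obtain ⟨p', hp'⟩ := (hP.symm rs).half
  obtain ⟨q, hq⟩ := hQ.half
  obtain ⟨q', hq'⟩ := (hQ.symm bs).half
  have hwx : g w ≠ g x := hux ▸ huw.symm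
  have huy : g u ≠ g y := hux ▸ hxy
  rcases h.total huy with e | e <;> rcases h.total hwx with e' | e'
  · exact ⟨_, Q, by rw [← hm]; abel, .inr ⟨_, _, .cons e' (hP.full.snoc (rs e))⟩, hQ.inner⟩
  · exact .of_paths (.cons e hp') (.cons e' hq) (by grind (ematch := 0))
  · exact .of_paths (.cons e' hp) (.cons e hq') (by grind (ematch := 0))
  · exact ⟨P, _, by rw [← hm]; abel, hP.inner, .inr ⟨_, _, .cons e' (hQ.full.snoc (bs e))⟩⟩

theorem hasSplit_of_open_aux (h : TwoColouring g R B) (hno : ¬ Splits R B m)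
    (hP : OpenPath R x P y) (hQ : OpenPath B x Q y)
    (hm : {x} + {y} + P + Q + {u} + {w} = m) (hxy : g x = g y) (huw : B u w)
    (hux : g u = g x) : HasSplit g R B m := by
  have rs : ∀ {x y}, R x y → R y x := h.red_symm
  have bs : ∀ {x y}, B x y → B y x := h.blue_symm
  have key : ∀ {x y}, g u = g x → OpenPath R x P y → OpenPath B x Q y →
      {x} + {y} + P + Q + {u} + {w} = m → R w x := by
    intro x y hux hP hQ hm
    refine h.red_of_not_blue (hux ▸ (h.blue_ne huw).symm) fun e => hno ?_
    exact ⟨P, _, by rw [← hm]; abel, hP.inner, .inr ⟨_, _, .cons huw (.cons e hQ.full)⟩⟩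
  have hwx := key hux hP hQ hm
  have hwy := key (hux.trans hxy) (hP.symm rs) (hQ.symm bs) (by rw [← hm]; abel)
  obtain ⟨-, e⟩ | ⟨q, q', hq, e, e'⟩ := hQ
  · exact (h.blue_ne e hxy).elim
  · refine h.hasSplit_of_cycle hno (.cons hwx hP.full) (rs hwy) hq ?_ (u := u) (by rw [← hm]; abel)
      (hux ▸ h.blue_ne e)
    exact Bool.eq_of_ne_of_ne' (h.blue_ne e') (hxy ▸ (h.blue_ne e).symm)

theorem splits_or_of_open (h : TwoColouring g R B) (hP : OpenPath R x P y) (hQ : OpenPath B x Q y)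
    (hm : {x} + {y} + P + Q + {u} + {w} = m) (huw : g u ≠ g w) :
    Splits R B m ∨ HasSplit g R B m := by
  wlog hux : g u = g x generalizing u w
  · exact this (by rw [← hm]; abel) huw.symm (Bool.eq_of_ne_of_ne' huw.symm (Ne.symm hux))
  by_cases hxy : g x = g y
  · refine or_iff_not_imp_left.2 fun hno => ?_
    rcases h.total huw with e | e
    · exact (h.swap.hasSplit_of_open_aux (mt .swap hno) hQ hP (by rw [← hm]; abel) hxy e hux).swap
    · exact h.hasSplit_of_open_aux hno hP hQ hm hxy e hux
  · exact .inl (h.splits_of_open_ne hP hQ hm hxy huw hux)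

end

end TwoColouring

/-- A path with more than one vertex has two ends and an interior. -/
theorem PathOn.single_or_open {V : Type*} {R : V → V → Prop} {a b : V} {s : Multiset V}
    (hR : ∀ {x y}, R x y → R y x) (h : PathOn R a s b) :
    (s = {a} ∧ a = b) ∨ ∃ P, OpenPath R a P b ∧ s = {a} + P + {b} := by
  rcases h.start_cases with h | ⟨p, s₁, h₁, e, rfl⟩
  · exact .inl h
  · rcases h₁.end_cases hR with ⟨rfl, rfl⟩ | ⟨p', P, h₂, e', rfl⟩
    · exact .inr ⟨0, .inl ⟨rfl, e⟩, by abel⟩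
    · exact .inr ⟨P, .inr ⟨p, p', h₂, e, e'⟩, by abel⟩

namespace TwoColouring
variable {V : Type*} {g : V → Bool} {R B : V → V → Prop} {m : Multiset V}

section
variable {u w r r' b b' : V} {s t : Multiset V}

theorem splits_or_of_path (h : TwoColouring g R B) (hs : PathOn R r s r')
    (hm : s + {u} + {w} = m) (huw : g u ≠ g w) (hrr : g r ≠ g r') :
    Splits R B m ∨ HasSplit g R B m := by
  refine or_iff_not_imp_left.2 fun hno => ?_
  have rs : ∀ {x y}, R x y → R y x := h.red_symm
  have bs : ∀ {x y}, B x y → B y x := h.blue_symm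
  wlog hru : g r = g u generalizing u w
  · exact this (by rw [← hm]; abel) huw.symm (Bool.eq_of_ne_of_ne' hru huw.symm)
  have hru' : g r' = g w := Bool.eq_of_ne_of_ne' hrr.symm (hru ▸ huw.symm)
  have huw' : R u w := h.red_of_not_blue huw fun e =>
    hno (.of_paths hs (.cons e (.single w)) (by rw [← hm]; abel))
  have hwr : B w r := h.blue_of_not_red (hru ▸ huw.symm) fun e =>
    hno (.of_path (.cons huw' (.cons e hs)) (by rw [← hm]; abel))
  have hur : B u r' := h.blue_of_not_red (hru' ▸ huw) fun e =>
    hno (.of_path (.cons (rs huw') (.cons e (hs.symm rs))) (by rw [← hm]; abel))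
  have hrr' : R r' r := h.red_of_not_blue hrr.symm fun e => hno <| by
    have hB := PathOn.cons hwr (.cons (bs e) (.cons (bs hur) (.single u)))
    rcases hs.single_or_open rs with ⟨-, rfl⟩ | ⟨P, hP, rfl⟩
    · exact (hrr rfl).elim
    · exact ⟨P, _, by rw [← hm]; abel, hP.inner, .inr ⟨_, _, hB⟩⟩
  exact h.hasSplit_of_cycle hno hs hrr' (.single w) rfl (by rw [← hm]; abel) huw

theorem splits_or_of_paths (h : TwoColouring g R B) (hs : PathOn R r s r') (ht : PathOn B b t b')
    (hm : s + t + {u} + {w} = m) (huw : g u ≠ g w) (hrb : g r ≠ g b) (hrb' : g r' ≠ g b') :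
    Splits R B m ∨ HasSplit g R B m := by
  have key : ∀ {R B : V → V → Prop} {r r' b b' s t}, TwoColouring g R B → PathOn R r s r' →
      PathOn B b t b' → s + t + {u} + {w} = m → g r ≠ g b → g r' ≠ g b' → R r b →
      Splits R B m ∨ HasSplit g R B m := by
    clear * - huw
    intro R B r r' b b' s t h hs ht hm hrb hrb' e
    have rs : ∀ {x y}, R x y → R y x := h.red_symm
    have bs : ∀ {x y}, B x y → B y x := h.blue_symm
    rcases h.total hrb' with e' | e'
    · rcases ht.single_or_open bs with ⟨rfl, rfl⟩ | ⟨Q, hQ, rfl⟩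
      · exact h.splits_or_of_path (hs.snoc e') hm huw hrb
      · exact h.splits_or_of_open (.inr ⟨r, r', hs, rs e, e'⟩) hQ (by rw [← hm]; abel) huw
    · have hP : ∃ P, OpenPath R b P r' ∧ s = {r'} + P := by
        rcases hs.end_cases rs with ⟨rfl, rfl⟩ | ⟨p, P, hP, e₁, rfl⟩
        · exact ⟨0, .inl ⟨rfl, rs e⟩, by abel⟩
        · exact ⟨P, .inr ⟨r, p, hP, rs e, e₁⟩, rfl⟩
      have hQ : ∃ Q, OpenPath B b Q r' ∧ t = {b} + Q := by
        rcases ht.start_cases with ⟨rfl, rfl⟩ | ⟨q, Q, hQ, e₁, rfl⟩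
        · exact ⟨0, .inl ⟨rfl, bs e'⟩, by abel⟩
        · exact ⟨Q, .inr ⟨q, b', hQ, e₁, bs e'⟩, rfl⟩
      obtain ⟨P, hP, rfl⟩ := hP
      obtain ⟨Q, hQ, rfl⟩ := hQ
      exact h.splits_or_of_open hP hQ (by rw [← hm]; abel) huw
  rcases h.total hrb with e | e
  · exact key h hs ht hm hrb hrb' e
  · exact (key h.swap ht hs (by rw [← hm]; abel) hrb.symm hrb'.symm (h.blue_symm e)).imp
      Splits.swap HasSplit.swap

/-- The ends of a red and a blue path covering a balanced set can be matched across the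
bipartition. -/
theorem matched_ends {r r' b b' : V} {s t : Multiset V} (h : TwoColouring g R B)
    (hs : PathOn R r s r') (ht : PathOn B b t b')
    (hc : 2 * (s + t).countP (g · = true) = (s + t).card) :
    g r ≠ g b ∧ g r' ≠ g b' ∨ g r ≠ g b' ∧ g r' ≠ g b := by
  have h1 := PathOn.two_mul_countP (R := R) h.red_ne hs true
  have h2 := PathOn.two_mul_countP (R := B) h.blue_ne ht true
  rw [Multiset.countP_add, Multiset.card_add] at hc
  revert h1 h2
  cases g r <;> cases g r' <;> cases g b <;> cases g b' <;> simp <;> omega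

theorem ends_ne (h : TwoColouring g R B) (hs : PathOn R r s r')
    (hc : 2 * s.countP (g · = true) = s.card) : g r ≠ g r' := by
  have h1 := PathOn.two_mul_countP (R := R) h.red_ne hs true
  revert h1
  cases g r <;> cases g r' <;> simp <;> omega

theorem splits_or_of_splits {m' : Multiset V} (h : TwoColouring g R B) (hm' : Splits R B m')
    (hc : 2 * m'.countP (g · = true) = m'.card) (huw : g u ≠ g w) (hm : m' + {u} + {w} = m) :
    Splits R B m ∨ HasSplit g R B m := by
  obtain ⟨s, t, rfl, rfl | ⟨r, r', hs⟩, rfl | ⟨b, b', ht⟩⟩ := hm'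
  · exact .inl (.of_paths (.single u) (.single w) (by simpa using hm))
  · rw [zero_add] at hc hm
    exact (h.swap.splits_or_of_path ht hm huw (h.swap.ends_ne ht hc)).imp .swap .swap
  · rw [add_zero] at hc hm
    exact h.splits_or_of_path hs hm huw (h.ends_ne hs hc)
  · rcases h.matched_ends hs ht hc with ⟨h1, h2⟩ | ⟨h1, h2⟩
    · exact h.splits_or_of_paths hs ht hm huw h1 h2
    · exact h.splits_or_of_paths hs (ht.symm h.blue_symm) hm huw h1 h2

end

end TwoColouring

theorem Multiset.exists_add_of_card {α : Type*} {X : Multiset α} {x : α} {n : ℕ} (hx : x ∈ X)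
    (hn : 1 ≤ n) (hn' : n ≤ X.card) : ∃ X' E, X' + E = X ∧ X'.card = n ∧ x ∈ X' := by
  obtain ⟨Y, rfl⟩ := Multiset.exists_cons_of_mem hx
  induction Y using Quotient.inductionOn with
  | h l =>
    refine ⟨x ::ₘ ↑(l.take (n - 1)), ↑(l.drop (n - 1)), ?_, ?_, by simp⟩
    · rw [Multiset.cons_add, Multiset.coe_add, List.take_append_drop]; rfl
    · simp at hn' ⊢; omega

theorem PathOn.zero_or_of_complete {V : Type*} {R : V → V → Prop} (hR : ∀ {x y}, R x y → R y x)
    {X Y : Multiset V} (hXY : ∀ x ∈ X, ∀ y ∈ Y, R x y) (hc : X.card = Y.card) :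
    X + Y = 0 ∨ ∃ a b, PathOn R a (X + Y) b := by
  rcases X.empty_or_exists_mem with rfl | ⟨x, hx⟩
  · left
    simpa using hc.symm
  · obtain ⟨y, hy⟩ : ∃ y, y ∈ Y := Multiset.card_pos_iff_exists_mem.1
      (hc ▸ Multiset.card_pos_iff_exists_mem.2 ⟨x, hx⟩)
    exact .inr ⟨x, y, .of_complete hR hXY hc hx hy⟩

namespace TwoColouring
variable {V : Type*} {g : V → Bool} {R B : V → V → Prop} {m : Multiset V}

section
variable {u w : V} {A₁ A₂ W₁ W₂ : Multiset V}

theorem splits_of_not_conforming (h : TwoColouring g R B) (hp : SplitParts g R B A₁ A₂ W₁ W₂)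
    (hc : (A₁ + A₂).card = (W₁ + W₂).card) (hm : A₁ + A₂ + W₁ + W₂ + {u} + {w} = m)
    (hw : ∀ x ∈ A₁ + A₂, g x ≠ g w)
    {c₁ c₂ : V} (h1 : c₁ ∈ W₁) (h2 : c₂ ∈ W₂) (e1 : B u c₁) (e2 : B u c₂) :
    Splits R B m := by
  have rs : ∀ {x y}, R x y → R y x := h.red_symm
  have bs : ∀ {x y}, B x y → B y x := h.blue_symm
  wlog hd : W₁.card ≤ A₁.card generalizing A₁ A₂ W₁ W₂ c₁ c₂
  · refine this hp.rotate (by rwa [add_comm, add_comm W₂]) (by rw [← hm]; abel)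
      (by rwa [add_comm]) h2 h1 e2 e1 ?_
    simp at hc; omega
  rw [Multiset.card_add, Multiset.card_add] at hc
  have c1 : 0 < W₁.card := Multiset.card_pos.2 hp.ne₃
  have c2 : 0 < A₂.card := Multiset.card_pos.2 hp.ne₂
  obtain ⟨x₂, hx₂⟩ := Multiset.exists_mem_of_ne_zero hp.ne₂
  obtain ⟨W, F, rfl, hW, hc₂⟩ := Multiset.exists_add_of_card (n := A₂.card) h2 (by omega) (by omega)
  rw [Multiset.card_add] at hc
  -- the blue path through `u` and the remaining vertices, for each subset `A` of `A₁`
  have main : ∀ A E, A + E = A₁ → A.card = W₁.card → E.card = F.card ∧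
      ∃ x ∈ A, PathOn B x (A + W₁ + ({u} + (W + A₂))) x₂ := by
    rintro A E rfl hA
    obtain ⟨x, hx⟩ := Multiset.card_pos_iff_exists_mem.1 (hA ▸ c1)
    refine ⟨by simp at hc; omega, x, hx, ?_⟩
    refine (PathOn.of_complete bs (fun x hx y hy => hp.blue₁ x (by simp [hx]) y hy) hA hx h1).append
      (bs e1) (.cons e2 (.of_complete bs (fun x hx y hy => bs (hp.blue₂ y hy x (by simp [hx]))) hW
      hc₂ hx₂))
  by_cases hred : ∃ a ∈ A₁, R w a
  · obtain ⟨a, ha, e⟩ := hred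
    rcases F.empty_or_exists_mem with rfl | ⟨y, hy⟩
    · obtain ⟨-, x, hx, hB⟩ := main A₁ 0 (by simp) (by simp at hc; omega)
      exact .swap (.of_singleton_right w hB (by rw [← hm]; abel))
    · have c3 : 0 < F.card := Multiset.card_pos_iff_exists_mem.2 ⟨y, hy⟩
      obtain ⟨E, A, rfl, hE, haE⟩ := Multiset.exists_add_of_card (n := F.card) ha c3 (by omega)
      obtain ⟨-, x, hx, hB⟩ := main A E (by rw [add_comm]) (by simp at hc; omega)
      exact .of_paths (.cons e (.of_complete rs (fun x hx y hy => hp.red₁ x (by simp [hx]) y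
        (by simp [hy])) hE haE hy)) hB (by rw [← hm]; abel)
  · push Not at hred
    obtain ⟨x, hx⟩ := Multiset.exists_mem_of_ne_zero hp.ne₁
    obtain ⟨A, E, rfl, hA, -⟩ := Multiset.exists_add_of_card (n := W₁.card) hx c1 hd
    obtain ⟨hE, x, hx, hB⟩ := main A E rfl hA
    have e := h.blue_of_not_red (hw x (by simp [hx])).symm (hred x (by simp [hx]))
    exact ⟨_, _, by rw [← hm]; abel, PathOn.zero_or_of_complete rs (fun x hx y hy =>
      hp.red₁ x (by simp [hx]) y (by simp [hy])) hE, .inr ⟨_, _, .cons e hB⟩⟩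

theorem splits_or_of_conforming (h : TwoColouring g R B) (hp : SplitParts g R B A₁ A₂ W₁ W₂)
    (hc : (A₁ + A₂).card = (W₁ + W₂).card) (hm : A₁ + A₂ + W₁ + W₂ + {u} + {w} = m)
    (hu : ∀ y ∈ W₁ + W₂, g u ≠ g y) (hw : ∀ x ∈ A₁ + A₂, g x ≠ g w) (huw : g u ≠ g w)
    (hu₁ : ∀ y ∈ W₁, B u y) (hu₂ : ∀ y ∈ W₂, R u y) (hw₁ : ∀ x ∈ A₁, B x w)
    (hw₂ : ∀ x ∈ A₂, R x w) : Splits R B m ∨ HasSplit g R B m := by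
  have rs : ∀ {x y}, R x y → R y x := h.red_symm
  have bs : ∀ {x y}, B x y → B y x := h.blue_symm
  rcases h.total huw with e | e
  · left
    have key : ∀ {X Y : Multiset V}, X ≠ 0 → Y ≠ 0 → (∀ x ∈ X, ∀ y ∈ Y, R x y) →
        ∃ X' E Y' F x y, X' + E = X ∧ Y' + F = Y ∧ x ∈ X ∧ y ∈ Y ∧ PathOn R x (X' + Y') y ∧
          X'.card = min X.card Y.card ∧ Y'.card = min X.card Y.card := by
      intro X Y hX hY hXY
      obtain ⟨x, hx⟩ := Multiset.exists_mem_of_ne_zero hX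
      obtain ⟨y, hy⟩ := Multiset.exists_mem_of_ne_zero hY
      rw [← Multiset.card_pos] at hX hY
      obtain ⟨X', E, rfl, h1, h2⟩ := Multiset.exists_add_of_card (n := min X.card Y.card) hx
        (by omega) (by omega)
      obtain ⟨Y', F, rfl, h3, h4⟩ := Multiset.exists_add_of_card (n := min (X' + E).card Y.card) hy
        (by omega) (by omega)
      exact ⟨X', E, Y', F, x, y, rfl, rfl, hx, hy, .of_complete rs (fun x hx y hy => hXY x
        (by simp [hx]) y (by simp [hy])) (h1.trans h3.symm) h2 h4, h1, h3⟩
    obtain ⟨X₁, E₁, Y₂, F₂, x₁, y₂, rfl, rfl, hx₁, hy₂, hR₁, h1, h2⟩ := key hp.ne₁ hp.ne₄ hp.red₁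
    obtain ⟨X₂, E₂, Y₁, F₁, x₂, y₁, rfl, rfl, hx₂, hy₁, hR₂, h3, h4⟩ := key hp.ne₂ hp.ne₃ hp.red₂
    have hR := hR₁.append (rs (hu₂ _ hy₂)) (.cons e (.cons (rs (hw₂ _ hx₂)) hR₂))
    simp only [Multiset.card_add] at hc h1 h2 h3 h4
    have hB : E₁ + F₁ + (E₂ + F₂) = 0 ∨ ∃ a b, PathOn B a (E₁ + F₁ + (E₂ + F₂)) b := by
      have : E₁.card = 0 ∧ F₁.card = 0 ∨ E₂.card = 0 ∧ F₂.card = 0 := by omega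
      simp only [Multiset.card_eq_zero] at this
      obtain ⟨rfl, rfl⟩ | ⟨rfl, rfl⟩ := this
      · rw [add_zero, zero_add]
        exact PathOn.zero_or_of_complete bs (fun x hx y hy => hp.blue₂ x (by simp [hx]) y (by simp [hy]))
          (by simp at *; omega)
      · rw [add_zero, add_zero]
        exact PathOn.zero_or_of_complete bs (fun x hx y hy => hp.blue₁ x (by simp [hx]) y (by simp [hy]))
          (by simp at *; omega)
    exact ⟨_, _, by rw [← hm]; abel, .inr ⟨_, _, hR⟩, hB⟩
  · right
    refine ⟨{u} + A₁, A₂, {w} + W₁, W₂, ⟨by simp, hp.ne₂, by simp, hp.ne₄, ?_, ?_, hp.blue₂, ?_, ?_⟩,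
      by rw [← hm]; abel⟩
    · have := hp.side
      simp only [Multiset.mem_add, Multiset.mem_singleton] at *
      rintro x ((rfl | hx) | hx) y ((rfl | hy) | hy)
      · exact huw
      · exact hu _ (.inl hy)
      · exact hu _ (.inr hy)
      · exact hw _ (.inl hx)
      · exact this _ (.inl hx) _ (.inl hy)
      · exact this _ (.inl hx) _ (.inr hy)
      · exact hw _ (.inr hx)
      · exact this _ (.inr hx) _ (.inl hy)
      · exact this _ (.inr hx) _ (.inr hy)
    · simp only [Multiset.mem_add, Multiset.mem_singleton]
      rintro x (rfl | hx) y (rfl | hy)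
      exacts [e, hu₁ _ hy, hw₁ _ hx, hp.blue₁ _ hx _ hy]
    · simp only [Multiset.mem_add, Multiset.mem_singleton]
      rintro x (rfl | hx) y hy
      exacts [hu₂ _ hy, hp.red₁ _ hx _ hy]
    · simp only [Multiset.mem_add, Multiset.mem_singleton]
      rintro x hx y (rfl | hy)
      exacts [hw₂ _ hx, hp.red₂ _ hx _ hy]

/-- A vertex either extends one of two parts of a split colouring or spoils both. -/
theorem conforming_or (h : TwoColouring g R B) (hW₁ : W₁ ≠ 0) (hW₂ : W₂ ≠ 0)
    (hu : ∀ y ∈ W₁ + W₂, g u ≠ g y) :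
    (∃ c₁ ∈ W₁, ∃ c₂ ∈ W₂, B u c₁ ∧ B u c₂) ∨ (∃ c₁ ∈ W₁, ∃ c₂ ∈ W₂, R u c₁ ∧ R u c₂) ∨
      ((∀ y ∈ W₁, B u y) ∧ ∀ y ∈ W₂, R u y) ∨ ((∀ y ∈ W₁, R u y) ∧ ∀ y ∈ W₂, B u y) := by
  obtain ⟨y₁, hy₁⟩ := Multiset.exists_mem_of_ne_zero hW₁
  obtain ⟨y₂, hy₂⟩ := Multiset.exists_mem_of_ne_zero hW₂
  have t1 : ∀ y ∈ W₁, R u y ∨ B u y := fun y hy => h.total (hu y (by simp [hy]))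
  have t2 : ∀ y ∈ W₂, R u y ∨ B u y := fun y hy => h.total (hu y (by simp [hy]))
  grind

theorem splits_or_of_parts (h : TwoColouring g R B) (hp : SplitParts g R B A₁ A₂ W₁ W₂)
    (hc : (A₁ + A₂).card = (W₁ + W₂).card) (hm : A₁ + A₂ + W₁ + W₂ + {u} + {w} = m)
    (hu : ∀ y ∈ W₁ + W₂, g u ≠ g y) (hw : ∀ x ∈ A₁ + A₂, g x ≠ g w) (huw : g u ≠ g w) :
    Splits R B m ∨ HasSplit g R B m := by
  have rs : ∀ {x y}, R x y → R y x := h.red_symm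
  have bs : ∀ {x y}, B x y → B y x := h.blue_symm
  have hcu := h.conforming_or hp.ne₃ hp.ne₄ hu
  have hcw := h.conforming_or hp.ne₁ hp.ne₂ fun x hx => (hw x hx).symm
  obtain ⟨c₁, h1, c₂, h2, e1, e2⟩ | ⟨c₁, h1, c₂, h2, e1, e2⟩ | hcu := hcu
  · exact .inl (h.splits_of_not_conforming hp hc hm hw h1 h2 e1 e2)
  · exact .inl (.swap (h.swap.splits_of_not_conforming hp.swap (by rwa [add_comm W₂])
      (by rw [← hm]; abel) hw h2 h1 e2 e1))
  have hp' := hp.transpose rs bs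
  have hu' := fun y hy => (hu y hy).symm
  obtain ⟨c₁, h1, c₂, h2, e1, e2⟩ | ⟨c₁, h1, c₂, h2, e1, e2⟩ | hcw := hcw
  · exact .inl (h.splits_of_not_conforming hp' hc.symm (by rw [← hm]; abel) hu' h1 h2 e1 e2)
  · exact .inl (.swap (h.swap.splits_of_not_conforming hp'.swap (by rw [← hc, add_comm])
      (by rw [← hm]; abel) hu' h2 h1 e2 e1))
  -- after renaming the parts, `u` extends the first of them
  wlog hcu' : (∀ y ∈ W₁, B u y) ∧ ∀ y ∈ W₂, R u y generalizing A₁ A₂ W₁ W₂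
  · refine this hp.rotate (by rwa [add_comm, add_comm W₂]) (by rw [← hm]; abel)
      (by rwa [add_comm]) (by rwa [add_comm]) (by tauto) hp'.rotate (by rwa [add_comm]) (by tauto)
      (by tauto)
  obtain ⟨hu₁, hu₂⟩ := hcu'
  obtain ⟨hw₁, hw₂⟩ | ⟨hw₁, hw₂⟩ := hcw
  · exact h.splits_or_of_conforming hp hc hm hu hw huw hu₁ hu₂ (fun x hx => bs (hw₁ x hx))
      fun x hx => rs (hw₂ x hx)
  · exact (h.swap.splits_or_of_conforming hp.swap (by rwa [add_comm W₂]) (by rw [← hm]; abel)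
      (by rwa [add_comm]) hw huw hu₂ hu₁ (fun x hx => rs (hw₁ x hx))
      fun x hx => bs (hw₂ x hx)).imp .swap .swap

end

end TwoColouring

namespace TwoColouring
variable {V : Type*} {g : V → Bool} {R B : V → V → Prop} {m : Multiset V}

theorem _root_.SplitParts.card_eq {A₁ A₂ W₁ W₂ : Multiset V} (hp : SplitParts g R B A₁ A₂ W₁ W₂)
    (hc : 2 * (A₁ + A₂ + W₁ + W₂).countP (g · = true) = (A₁ + A₂ + W₁ + W₂).card) :
    ∃ β, (∀ x ∈ A₁ + A₂, g x = β) ∧ (∀ y ∈ W₁ + W₂, g y ≠ β) ∧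
      (A₁ + A₂).card = (W₁ + W₂).card := by
  obtain ⟨x₀, hx₀⟩ := Multiset.exists_mem_of_ne_zero hp.ne₁
  obtain ⟨y₀, hy₀⟩ := Multiset.exists_mem_of_ne_zero hp.ne₃
  have hA : ∀ x ∈ A₁ + A₂, g x = g x₀ := fun x hx => Bool.eq_of_ne_of_ne'
    (hp.side x hx y₀ (by simp [hy₀])) (hp.side x₀ (by simp [hx₀]) y₀ (by simp [hy₀]))
  have hW : ∀ y ∈ W₁ + W₂, g y ≠ g x₀ := fun y hy => (hp.side x₀ (by simp [hx₀]) y hy).symm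
  refine ⟨g x₀, hA, hW, ?_⟩
  rw [add_assoc (A₁ + A₂), Multiset.card_add, Multiset.countP_add] at hc
  cases h : g x₀ <;> rw [h] at hA hW
  · rw [Multiset.countP_eq_zero.2 (by simpa using hA),
      Multiset.countP_eq_card.2 (by simpa using hW)] at hc
    omega
  · rw [Multiset.countP_eq_card.2 hA, Multiset.countP_eq_zero.2 hW] at hc
    omega

/-- A two-coloured balanced complete bipartite graph has a cover by a red and a blue path, unless
its colouring is a split colouring. -/
theorem splits_or_hasSplit (h : TwoColouring g R B)
    (hc : 2 * m.countP (g · = true) = m.card) : Splits R B m ∨ HasSplit g R B m := by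
  induction hn : m.card using Nat.strong_induction_on generalizing m with
  | _ n ih =>
  rcases eq_or_ne m 0 with rfl | hm0
  · exact .inl ⟨0, 0, rfl, .inl rfl, .inl rfl⟩
  have hcard := Multiset.card_pos.2 hm0
  obtain ⟨u, hum, hu⟩ := Multiset.countP_pos.1 (show 0 < m.countP (g · = true) by omega)
  obtain ⟨m₁, rfl⟩ := Multiset.exists_cons_of_mem hum
  obtain ⟨w, hwm, hw⟩ : ∃ w ∈ m₁, g w ≠ true := by
    by_contra! hall
    rw [Multiset.countP_eq_card.2 (by simpa [hu] using hall)] at hc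
    omega
  obtain ⟨m', rfl⟩ := Multiset.exists_cons_of_mem hwm
  have hc' : 2 * m'.countP (g · = true) = m'.card := by simp [hu, hw] at hc; omega
  have huw : g u ≠ g w := hu ▸ hw.symm
  rcases ih m'.card (by simp at hn; omega) hc' rfl with h1 | ⟨A₁, A₂, W₁, W₂, hp, rfl⟩
  · exact h.splits_or_of_splits h1 hc' huw (by simp only [← Multiset.singleton_add]; abel)
  · obtain ⟨β, hA, hW, hcd⟩ := hp.card_eq hc'
    have key : ∀ {u' w'}, g u' = β → g w' ≠ β → A₁ + A₂ + W₁ + W₂ + {u'} + {w'} =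
        u ::ₘ w ::ₘ (A₁ + A₂ + W₁ + W₂) → Splits R B (u ::ₘ w ::ₘ (A₁ + A₂ + W₁ + W₂)) ∨
          HasSplit g R B (u ::ₘ w ::ₘ (A₁ + A₂ + W₁ + W₂)) := fun hu' hw' e =>
      h.splits_or_of_parts hp hcd e (fun y hy => hu' ▸ (hW y hy).symm)
        (fun x hx => (hA x hx).symm ▸ hw'.symm) (hu' ▸ hw'.symm)
    by_cases hub : g u = β
    · exact key hub (hub ▸ huw.symm) (by simp only [← Multiset.singleton_add]; abel)
    · exact key (Bool.eq_of_ne_of_ne' huw.symm (Ne.symm hub)) hub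
        (by simp only [← Multiset.singleton_add]; abel)

end TwoColouring

namespace TwoColouring
variable {V κ : Type*} [DecidableEq κ] {f : V → κ} {g : V → Bool} {R B : V → V → Prop}
  {m : Multiset V} {q : κ}

theorem splits_of_parts (h : TwoColouring f R B) {A₁ A₂ W₁ W₂ : Multiset V}
    (hp : SplitParts g R B A₁ A₂ W₁ W₂) (hc : (A₁ + A₂).card = (W₁ + W₂).card)
    (hm : A₁ + A₂ + W₁ + W₂ = m) (hA : ∀ x ∈ A₁ + A₂, f x = q) (hW : ∀ y ∈ W₁ + W₂, f y ≠ q)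
    {c₁ c₂ : V} (h1 : c₁ ∈ W₁) (h2 : c₂ ∈ W₂) (e : B c₁ c₂) :
    Splits R B m ∧ ∀ v, f v ≠ q → Fair f (m + {v}) → Splits R B (m + {v}) := by
  have rs : ∀ {x y}, R x y → R y x := h.red_symm
  have bs : ∀ {x y}, B x y → B y x := h.blue_symm
  wlog hd : W₁.card ≤ A₁.card generalizing A₁ A₂ W₁ W₂ c₁ c₂
  · refine this hp.rotate (by rwa [add_comm, add_comm W₂]) (by rw [← hm]; abel)
      (by rwa [add_comm]) (by rwa [add_comm]) h2 h1 (bs e) ?_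
    simp at hc; omega
  rw [Multiset.card_add, Multiset.card_add] at hc
  have c1 : 0 < W₁.card := Multiset.card_pos.2 hp.ne₃
  have c2 : 0 < A₂.card := Multiset.card_pos.2 hp.ne₂
  obtain ⟨x₁, hx₁⟩ := Multiset.exists_mem_of_ne_zero hp.ne₁
  obtain ⟨x₂, hx₂⟩ := Multiset.exists_mem_of_ne_zero hp.ne₂
  obtain ⟨W, F, rfl, hW', hc₂⟩ := Multiset.exists_add_of_card (n := A₂.card) h2 (by omega)
    (by omega)
  obtain ⟨A, E, rfl, hA', ha⟩ := Multiset.exists_add_of_card (n := W₁.card) hx₁ c1 hd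
  have hB : PathOn B x₁ (A + W₁ + (W + A₂)) x₂ :=
    (PathOn.of_complete bs (fun x hx y hy => hp.blue₁ x (by simp [hx]) y hy) hA' ha h1).append e
      (.of_complete bs (fun x hx y hy => bs (hp.blue₂ y hy x (by simp [hx]))) hW' hc₂ hx₂)
  have hEF : E.card = F.card := by simp at hc; omega
  have hR : ∀ x ∈ E, ∀ y ∈ F, R x y := fun x hx y hy => hp.red₁ x (by simp [hx]) y (by simp [hy])
  rcases E.empty_or_exists_mem with rfl | ⟨x, hx⟩
  · obtain rfl : F = 0 := by simpa using hEF.symm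
    exact ⟨.swap (.of_path hB (by rw [← hm]; abel)), fun v _ _ =>
      .swap (.of_singleton_right v hB (by rw [← hm]; abel))⟩
  · obtain ⟨y, hy⟩ : ∃ y, y ∈ F := Multiset.card_pos_iff_exists_mem.1
      (hEF ▸ Multiset.card_pos_iff_exists_mem.2 ⟨x, hx⟩)
    have hxy := PathOn.of_complete rs hR hEF hx hy
    refine ⟨.of_paths hxy hB (by rw [← hm]; abel), fun v hv hf => ?_⟩
    have hxq := hA x (by simp [hx])
    exact h.splits_of_three_ends hf hxy hB (by rw [← hm]; abel)
      ((hA _ (by simp [ha])).trans hxq.symm) ((hA _ (by simp [hx₂])).trans hxq.symm)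
      (hxq ▸ hW y (by simp [hy])) (hxq ▸ hv)

theorem restrict (h : TwoColouring f R B) (q : κ) :
    TwoColouring (fun x => decide (f x = q)) (fun x y => R x y ∧ decide (f x = q) ≠ decide (f y = q))
      (fun x y => B x y ∧ decide (f x = q) ≠ decide (f y = q)) :=
  ⟨fun e => ⟨h.red_symm e.1, e.2.symm⟩, fun e => ⟨h.blue_symm e.1, e.2.symm⟩, fun e => e.2,
    fun e => e.2, fun {x y} e => (h.total (x := x) (y := y) fun e' => e (by simp [e'])).imp
      (⟨·, e⟩) (⟨·, e⟩)⟩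

/-- If half of the vertices lie in the class `q`, then the remaining classes are merged. -/
theorem splits_of_half (h : TwoColouring f R B) (hc : 2 * m.countP (f · = q) = m.card)
    (hm : m.card ≤ 2 ∨ ∃ x ∈ m, ∃ y ∈ m, f x ≠ q ∧ f y ≠ q ∧ f x ≠ f y) :
    Splits R B m ∧ ∀ v, f v ≠ q → Fair f (m + {v}) → Splits R B (m + {v}) := by
  have hq := h.restrict q
  have hc' : 2 * m.countP (fun x => decide (f x = q) = true) = m.card := by simpa using hc
  have hne : ∀ {x y}, decide (f x = q) ≠ decide (f y = q) → f x ≠ f y := fun e e' => e (by simp [e'])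
  rcases hq.splits_or_hasSplit hc' with
    ⟨s, t, rfl, rfl | ⟨r, r', hs⟩, rfl | ⟨b, b', ht⟩⟩ | ⟨A₁, A₂, W₁, W₂, hp, rfl⟩
  · exact ⟨⟨0, 0, rfl, .inl rfl, .inl rfl⟩, fun v _ _ => .of_path (.single v) (by simp)⟩
  · have ht' := ht.mono And.left
    exact ⟨.swap (.of_path ht' (by simp)), fun v _ _ =>
      .swap (.of_singleton_right v ht' (by simp))⟩
  · have hs' := hs.mono And.left
    exact ⟨.of_path hs' (by simp), fun v _ _ => .of_singleton_right v hs' (by simp)⟩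
  · have hs' := hs.mono And.left
    have ht' := ht.mono And.left
    refine ⟨.of_paths hs' ht' rfl, fun v _ hf => ?_⟩
    rcases hq.matched_ends hs ht hc' with ⟨h1, h2⟩ | ⟨h1, h2⟩
    · exact h.splits_of_matched hf hs' ht' rfl (hne h1) (hne h2)
    · exact h.splits_of_matched hf hs' (ht'.symm h.blue_symm) rfl (hne h1) (hne h2)
  · obtain ⟨β, hA, hW, hcd⟩ := hp.card_eq hc'
    replace hp : SplitParts (fun x => decide (f x = q)) R B A₁ A₂ W₁ W₂ :=
      ⟨hp.ne₁, hp.ne₂, hp.ne₃, hp.ne₄, hp.side, fun x hx y hy => (hp.blue₁ x hx y hy).1,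
        fun x hx y hy => (hp.blue₂ x hx y hy).1, fun x hx y hy => (hp.red₁ x hx y hy).1,
        fun x hx y hy => (hp.red₂ x hx y hy).1⟩
    clear hc hc'
    wlog hβ : β = true generalizing A₁ A₂ W₁ W₂ β
    · have e : W₁ + W₂ + A₁ + A₂ = A₁ + A₂ + W₁ + W₂ := by abel
      have := this W₁ W₂ A₁ A₂ (e.symm ▸ hm) true (fun x hx => by simpa [hβ] using hW x hx)
        (fun x hx => by rw [hA x hx]; exact hβ) hcd.symm (hp.transpose h.red_symm h.blue_symm) rfl
      rwa [e] at this
    subst hβ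
    simp only [ne_eq, decide_eq_true_eq] at hA hW
    have c1 := Multiset.card_pos.2 hp.ne₁
    have c2 := Multiset.card_pos.2 hp.ne₂
    have hxy : ∃ x ∈ W₁, ∃ y ∈ W₂, f x ≠ f y := by
      rcases hm with hm | ⟨x, hx, y, hy, hxq, hyq, hxy⟩
      · simp at hm hcd; omega
      obtain ⟨w₁, hw₁⟩ := Multiset.exists_mem_of_ne_zero hp.ne₃
      obtain ⟨w₂, hw₂⟩ := Multiset.exists_mem_of_ne_zero hp.ne₄
      have hm : ∀ x ∈ A₁ + A₂ + W₁ + W₂, f x ≠ q → x ∈ W₁ ∨ x ∈ W₂ := by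
        intro x hx hxq
        have := hA x
        simp only [Multiset.mem_add] at *
        tauto
      have h1 := hm x hx hxq
      have h2 := hm y hy hyq
      grind
    obtain ⟨x, hx, y, hy, hxy⟩ := hxy
    rcases h.total hxy with e | e
    · obtain ⟨h1, h2⟩ := h.swap.splits_of_parts hp.swap (by rwa [add_comm W₂]) rfl hA
        (by rwa [add_comm]) hy hx (h.red_symm e)
      have e : A₁ + A₂ + W₂ + W₁ = A₁ + A₂ + W₁ + W₂ := by abel
      rw [e] at h1 h2
      exact ⟨h1.swap, fun v hv hf => (h2 v hv hf).swap⟩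
    · exact h.splits_of_parts hp hcd rfl hA hW hx hy e

end TwoColouring

namespace TwoColouring
variable {V : Type*} {f : V → Fin 3} {R B : V → V → Prop} {m : Multiset V}

theorem _root_.Multiset.card_eq_countP_fin_three (f : V → Fin 3) (m : Multiset V) :
    m.card = m.countP (f · = 0) + m.countP (f · = 1) + m.countP (f · = 2) := by
  induction m using Multiset.induction_on with
  | empty => simp
  | cons a m ih =>
    have : f a = 0 ∨ f a = 1 ∨ f a = 2 := by omega
    rcases this with h | h | h <;> simp [h, ih] <;> omega

theorem Fair.countP_pos (hm : Fair f m) (q : Fin 3) : 0 < m.countP (f · = q) := by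
  obtain ⟨x, hx, h1, h2⟩ := hm.third (q + 1) (q + 2)
  exact Multiset.countP_pos.2 ⟨x, hx, by omega⟩

theorem Fair.of_countP_pos (hm : ∀ q, 2 * m.countP (f · = q) ≤ m.card)
    (hpos : ∀ q, 0 < m.countP (f · = q)) : Fair f m where
  fair := hm
  third p q := by
    obtain ⟨r, hrp, hrq⟩ : ∃ r : Fin 3, r ≠ p ∧ r ≠ q := by
      revert p q; decide
    obtain ⟨x, hx, rfl⟩ := Multiset.countP_pos.1 (hpos r)
    exact ⟨x, hx, hrp, hrq⟩

theorem splits_of_almost_half (h : TwoColouring f R B) (hm : Fair f m) {q : Fin 3}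
    (hc : 2 * m.countP (f · = q) + 1 = m.card) : Splits R B m := by
  obtain ⟨v, m', rfl, hv, hm'⟩ : ∃ v m', v ::ₘ m' = m ∧ f v ≠ q ∧
      (m'.card ≤ 2 ∨ ∃ x ∈ m', ∃ y ∈ m', f x ≠ q ∧ f y ≠ q ∧ f x ≠ f y) := by
    by_cases hn : m.card ≤ 3
    · obtain ⟨v, hv, h1, -⟩ := hm.third q q
      obtain ⟨m', rfl⟩ := Multiset.exists_cons_of_mem hv
      exact ⟨v, m', rfl, h1, .inl (by simp at hn; omega)⟩
    · obtain ⟨p, hpq, hp⟩ : ∃ p, p ≠ q ∧ 2 ≤ m.countP (f · = p) := by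
        have := m.card_eq_countP_fin_three f
        by_contra! hall
        have h0 := hall 0
        have h1 := hall 1
        have h2 := hall 2
        have : q = 0 ∨ q = 1 ∨ q = 2 := by omega
        rcases this with rfl | rfl | rfl <;> simp at h0 h1 h2 <;> omega
      obtain ⟨v, hv, rfl⟩ := Multiset.countP_pos.1 (show 0 < m.countP (f · = p) by omega)
      obtain ⟨m', rfl⟩ := Multiset.exists_cons_of_mem hv
      obtain ⟨x, hx, hxv⟩ := Multiset.countP_pos.1 (show 0 < m'.countP (f · = f v) by
        simp at hp; omega)
      obtain ⟨y, hy, h1, h2⟩ := hm.third (f v) q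
      have hy : y ∈ m' := (Multiset.mem_cons.1 hy).resolve_left (by rintro rfl; exact h1 rfl)
      exact ⟨v, m', rfl, hpq, .inr ⟨x, hx, y, hy, hxv ▸ hpq, h2, hxv ▸ h1.symm⟩⟩
  rw [← Multiset.singleton_add, add_comm] at *
  refine (h.splits_of_half (q := q) ?_ hm').2 v hv hm
  simp [hv, ← Multiset.cons_zero] at hc
  omega

theorem splits_add_triple (h : TwoColouring f R B) {u v w : V} (hs : Splits R B m)
    (hcard : 2 ≤ m.card) (hm : Fair f (m + {u} + {v} + {w})) (huv : f u ≠ f v) (huw : f u ≠ f w)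
    (hvw : f v ≠ f w) : Splits R B (m + {u} + {v} + {w}) := by
  have key : ∀ {R B : V → V → Prop} {b b' m}, TwoColouring f R B → PathOn B b m b' →
      2 ≤ m.card → Fair f (m + {u} + {v} + {w}) → Splits R B (m + {u} + {v} + {w}) := by
    clear * - huv huw hvw
    intro R B b b' m h ht hc hm
    rcases ht.start_cases with ⟨rfl, -⟩ | ⟨c, t, ht', -, rfl⟩
    · simp at hc
    · exact h.splits_of_triple hm (.single b) ht' rfl huv huw hvw
  obtain ⟨s, t, rfl, rfl | ⟨r, r', hs⟩, rfl | ⟨b, b', ht⟩⟩ := hs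
  · simp at hcard
  · rw [zero_add] at *
    exact key h ht hcard hm
  · rw [add_zero] at *
    exact .swap (key h.swap hs hcard hm)
  · exact h.splits_of_triple hm hs ht rfl huv huw hvw

/-- A two-coloured fair complete tripartite graph splits into a red and a blue path. -/
theorem splits_of_fair (h : TwoColouring f R B) (hm : Fair f m) : Splits R B m := by
  induction hn : m.card using Nat.strong_induction_on generalizing m with
  | _ n ih =>
  by_cases h1 : ∃ q, 2 * m.countP (f · = q) = m.card
  · obtain ⟨q, hq⟩ := h1
    obtain ⟨x, hx, hxq, -⟩ := hm.third q q
    obtain ⟨y, hy, hyq, hxy⟩ := hm.third q (f x)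
    exact (h.splits_of_half hq (.inr ⟨x, hx, y, hy, hxq, hyq, hxy.symm⟩)).1
  by_cases h2 : ∃ q, 2 * m.countP (f · = q) + 1 = m.card
  · exact h.splits_of_almost_half hm h2.choose_spec
  push Not at h1 h2
  have hlt : ∀ q, 2 * m.countP (f · = q) + 2 ≤ m.card := fun q => by
    have := hm.fair q; have := h1 q; have := h2 q; omega
  have hsum := m.card_eq_countP_fin_three f
  have hge : ∀ q, 2 ≤ m.countP (f · = q) := fun q => by
    have e0 := hlt 0; have e1 := hlt 1; have e2 := hlt 2
    have : q = 0 ∨ q = 1 ∨ q = 2 := by omega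
    rcases this with rfl | rfl | rfl <;> omega
  obtain ⟨u, hu, hu0⟩ := Multiset.countP_pos.1 (hm.countP_pos 0)
  obtain ⟨m₁, rfl⟩ := Multiset.exists_cons_of_mem hu
  obtain ⟨v, hv, hv1⟩ := Multiset.countP_pos.1 (hm.countP_pos 1)
  obtain ⟨m₂, rfl⟩ := Multiset.exists_cons_of_mem
    ((Multiset.mem_cons.1 hv).resolve_left (by rintro rfl; simp [hu0] at hv1))
  obtain ⟨w, hw, hw2⟩ := Multiset.countP_pos.1 (hm.countP_pos 2)
  obtain ⟨m', rfl⟩ := Multiset.exists_cons_of_mem (((Multiset.mem_cons.1 hw).resolve_left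
    (by rintro rfl; simp [hu0] at hw2)) |> Multiset.mem_cons.1 |>.resolve_left
    (by rintro rfl; simp [hv1] at hw2))
  have hcount : ∀ q, (u ::ₘ v ::ₘ w ::ₘ m').countP (f · = q) = m'.countP (f · = q) + 1 := by
    intro q
    have : q = 0 ∨ q = 1 ∨ q = 2 := by omega
    rcases this with rfl | rfl | rfl <;> simp [hu0, hv1, hw2]
  simp only [hcount, Multiset.card_cons] at hlt hge hn
  have hm' : Fair f m' := .of_countP_pos (fun q => by have := hlt q; omega)
    fun q => by have := hge q; omega
  have e : m' + {u} + {v} + {w} = u ::ₘ v ::ₘ w ::ₘ m' := by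
    simp only [← Multiset.singleton_add]; abel
  have := h.splits_add_triple (u := u) (v := v) (w := w) (ih m'.card (by omega) hm' rfl)
    (by have := hlt 0; have := hge 0; omega) (e.symm ▸ hm) (by omega) (by omega) (by omega)
  rwa [e] at this

end TwoColouring

/-- A path on the elements of a duplicate-free multiset is a path in the graph. -/
theorem PathOn.exists_isPath {V : Type*} {G : SimpleGraph V} {c : Sym2 V → Bool} {β : Bool}
    {a b : V} {s : Multiset V} (h : PathOn (fun x y => G.Adj x y ∧ c s(x, y) = β) a s b)
    (hs : s.Nodup) :
    ∃ p : G.Walk a b, p.IsPath ∧ (∀ e ∈ p.edges, c e = β) ∧ ∀ x, x ∈ p.support ↔ x ∈ s := by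
  induction h with
  | single a => exact ⟨.nil, by simp, by simp, by simp⟩
  | cons e _ ih =>
    rw [Multiset.singleton_add, Multiset.nodup_cons] at hs
    obtain ⟨p, h1, h2, h3⟩ := ih hs.2
    refine ⟨.cons e.1 p, h1.cons (by rw [h3]; exact hs.1), ?_, fun x => by simp [h3]⟩
    simpa [e.2] using h2

theorem isMonoPathSet_of_pathOn {V : Type*} {G : SimpleGraph V} {c : Sym2 V → Bool} {β : Bool}
    {s : Multiset V} (h : s = 0 ∨ ∃ a b, PathOn (fun x y => G.Adj x y ∧ c s(x, y) = β) a s b)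
    (hs : s.Nodup) : IsMonoPathSet G c β {x | x ∈ s} := by
  rcases h with rfl | ⟨a, b, h⟩
  · exact .inl (by simp)
  · obtain ⟨p, h1, h2, h3⟩ := h.exists_isPath hs
    exact .inr ⟨a, b, p, h1, h2, by simp [h3]⟩

/-- The classes of a fair complete multipartite graph with at least three classes can be merged
into three classes, keeping it fair. -/
theorem exists_merge {V : Type*} [Fintype V] {k : ℕ} (hk : 3 ≤ k) {f : V → Fin k}
    (hf : Function.Surjective f)
    (hfair : ∀ i, 2 * (Finset.univ.filter (f · = i)).card ≤ Fintype.card V) :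
    ∃ φ : Fin k → Fin 3, Function.Surjective φ ∧
      ∀ j, 2 * (Finset.univ.filter fun x => φ (f x) = j).card ≤ Fintype.card V := by
  have hpos : 0 < Fintype.card V := Fintype.card_pos_iff.2 ⟨(hf ⟨0, by omega⟩).choose⟩
  have hex : ∃ t, Fintype.card V < 2 * (Finset.univ.filter fun x => (f x).val ≤ t).card := by
    refine ⟨k, ?_⟩
    rw [Finset.filter_true_of_mem fun x _ => (f x).isLt.le, Finset.card_univ]
    omega
  obtain ⟨t, ht, hmin⟩ : ∃ t, Fintype.card V < 2 * (Finset.univ.filter fun x => (f x).val ≤ t).card ∧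
      ∀ t' < t, 2 * (Finset.univ.filter fun x => (f x).val ≤ t').card ≤ Fintype.card V :=
    ⟨Nat.find hex, Nat.find_spec hex, fun t' h => not_lt.1 (Nat.find_min hex h)⟩
  have hmono : ∀ {p q : V → Prop} [DecidablePred p] [DecidablePred q], (∀ x, p x → q x) →
      (Finset.univ.filter p).card ≤ (Finset.univ.filter q).card := fun hpq =>
    Finset.card_le_card fun x => by simpa using hpq x
  have h0 : 0 < t := by
    by_contra h0
    have h1 := hfair ⟨0, by omega⟩
    have h2 := hmono (p := fun x => (f x).val ≤ t) (q := fun x => f x = ⟨0, by omega⟩)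
      fun x hx => Fin.ext (by simp; omega)
    omega
  have htk : t < k := by
    by_contra htk
    have h1 := hmin (k - 1) (by omega)
    have h2 := hmono (p := fun x => (f x).val ≤ t) (q := fun x => (f x).val ≤ k - 1)
      fun x _ => by omega
    omega
  have hlt := hmin (t - 1) (by omega)
  by_cases hlast : t + 1 = k
  · refine ⟨fun i => if i.val = 0 then 0 else if i.val = t then 1 else 2, fun j => ?_, fun j => ?_⟩
    · have : j = 0 ∨ j = 1 ∨ j = 2 := by omega
      rcases this with rfl | rfl | rfl
      · exact ⟨⟨0, by omega⟩, by simp⟩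
      · exact ⟨⟨t, htk⟩, by simp; omega⟩
      · exact ⟨⟨1, by omega⟩, by simp; omega⟩
    · have : j = 0 ∨ j = 1 ∨ j = 2 := by omega
      rcases this with rfl | rfl | rfl
      · refine le_trans (Nat.mul_le_mul_left 2 (hmono fun x hx => ?_)) (hfair ⟨0, by omega⟩)
        grind
      · refine le_trans (Nat.mul_le_mul_left 2 (hmono fun x hx => ?_)) (hfair ⟨t, htk⟩)
        grind
      · refine le_trans (Nat.mul_le_mul_left 2 (hmono fun x hx => ?_)) hlt
        grind
  · refine ⟨fun i => if i.val < t then 0 else if i.val = t then 1 else 2, fun j => ?_, fun j => ?_⟩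
    · have : j = 0 ∨ j = 1 ∨ j = 2 := by omega
      rcases this with rfl | rfl | rfl
      · exact ⟨⟨0, by omega⟩, by simp; omega⟩
      · exact ⟨⟨t, htk⟩, by simp⟩
      · exact ⟨⟨t + 1, by omega⟩, by simp⟩
    · have : j = 0 ∨ j = 1 ∨ j = 2 := by omega
      rcases this with rfl | rfl | rfl
      · refine le_trans (Nat.mul_le_mul_left 2 (hmono fun x hx => ?_)) hlt
        grind
      · refine le_trans (Nat.mul_le_mul_left 2 (hmono fun x hx => ?_)) (hfair ⟨t, htk⟩)
        grind
      · have h1 := Finset.card_filter_add_card_filter_not (s := Finset.univ) fun x => (f x).val ≤ t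
        rw [Finset.card_univ] at h1
        refine le_trans (Nat.mul_le_mul_left 2 (hmono (q := fun x => ¬ (f x).val ≤ t)
          fun x hx => ?_)) (by omega)
        grind

/-- Any fair complete `k`-partite graph, `k ≥ 3`, whose edges are coloured red and blue,
can be partitioned into the vertex set of a red path and the vertex set of a blue path. -/
theorem stmt0 {V : Type*} [Fintype V] (k : ℕ) (hk : 3 ≤ k)
    (f : V → Fin k) (hf : Function.Surjective f)
    (G : SimpleGraph V) (hG : ∀ x y, G.Adj x y ↔ f x ≠ f y)
    (hfair : ∀ i : Fin k, 2 * ({v | f v = i} : Set V).ncard ≤ Fintype.card V)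
    (c : Sym2 V → Bool) :
    ∃ S T : Set V, IsMonoPathSet G c true S ∧ IsMonoPathSet G c false T ∧
      Disjoint S T ∧ S ∪ T = Set.univ := by
  obtain ⟨φ, hφ, hφf⟩ := exists_merge hk hf fun i => by
    simpa [Set.ncard_eq_toFinset_card'] using hfair i
  let R (β : Bool) (x y : V) : Prop := (G.Adj x y ∧ c s(x, y) = β) ∧ φ (f x) ≠ φ (f y)
  have hR : ∀ β {x y}, R β x y → R β y x := fun β x y h =>
    ⟨⟨h.1.1.symm, by rw [Sym2.eq_swap]; exact h.1.2⟩, h.2.symm⟩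
  have h : TwoColouring (fun x => φ (f x)) (R true) (R false) :=
    ⟨hR true, hR false, fun e => e.2, fun e => e.2, fun {x y} e => by
      have hxy : G.Adj x y := (hG x y).2 fun e' => e (by rw [e'])
      cases hc : c s(x, y)
      · exact .inr ⟨⟨hxy, hc⟩, e⟩
      · exact .inl ⟨⟨hxy, hc⟩, e⟩⟩
  have hm : TwoColouring.Fair (fun x => φ (f x)) (Finset.univ : Finset V).val := by
    refine .of_countP_pos (fun q => ?_) fun q => ?_
    · rw [Multiset.countP_eq_card_filter]; exact hφf q
    · obtain ⟨x, hx⟩ := (hφ.comp hf) q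
      exact Multiset.countP_pos.2 ⟨x, Finset.mem_univ x, hx⟩
  obtain ⟨s, t, hst, hs, ht⟩ := h.splits_of_fair hm
  have hnd : (s + t).Nodup := hst ▸ Finset.univ.nodup
  rw [Multiset.nodup_add] at hnd
  refine ⟨{x | x ∈ s}, {x | x ∈ t},
    isMonoPathSet_of_pathOn (hs.imp_right fun ⟨a, b, h⟩ => ⟨a, b, h.mono And.left⟩) hnd.1,
    isMonoPathSet_of_pathOn (ht.imp_right fun ⟨a, b, h⟩ => ⟨a, b, h.mono And.left⟩) hnd.2.1,
    Set.disjoint_left.2 fun x hx hx' => Multiset.disjoint_left.1 hnd.2.2 hx hx', ?_⟩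
  refine Set.eq_univ_of_forall fun x => ?_
  have : x ∈ s + t := hst ▸ Finset.mem_univ x
  simpa using this
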